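/- arXiv:2512.13634 — 2 statements merged into one kernel-verified Lean document; each statement's English description precedes it below -/
import Mathlib

section
/- Consider a projective model with data X drawn from the ν-MM, where ν has mean zero and variance one, and suppose Assumption A holds with exponent q ≥ 1. Suppose the class means satisfy μ^a ∈ D_ζ and max_a ||μ^a|| = O(1). Then for every ζ ≤ 1/8, every R > 0, and every function F in the family G₀ := { (∂_{1,a}ψ)·⟨X, μ^b⟩, (∂_{1,a}ψ)·⟨X, θ^{a'}⟩, ∂_{2,b}ψ, (∂_{1,a}ψ)(∂_{1,a'}ψ), (∂_{1,a}ψ)^p, (∂_{2,b}ψ)^p : a,a' ∈ [k₁], b ∈ [k₂], p ∈ [20] } (with the derivatives of ψ evaluated at (θᵀX, w, y)), there exists C > 0, depending on F, R, and the moments of ν, such that for all Θ = (θ, w) with ||Θ||₂ ≤ R: |E[F(X)] − Ē[F(X̄)]| ≤ C · (max_a ||θ^a||₃³ ∨ ||μ^a||₃³), where E is expectation for the ν-MM and Ē for the Gaussian mixture model with the same means, weights, and unit variance. -/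
open MeasureTheory ProbabilityTheory Filter Finset

/-- Partial derivative `∂_{1,a}ψ` of `ψ` in the `a`-th coordinate of its first argument. -/
noncomputable def d1 {k₁ k₂ C : ℕ} (ψ : (Fin k₁ → ℝ) → (Fin k₂ → ℝ) → Fin C → ℝ)
    (a : Fin k₁) (v : Fin k₁ → ℝ) (w : Fin k₂ → ℝ) (y : Fin C) : ℝ :=
  fderiv ℝ (fun z => ψ z w y) v (Pi.single a 1)

/-- Partial derivative `∂_{2,b}ψ` of `ψ` in the `b`-th coordinate of its second argument. -/
noncomputable def d2 {k₁ k₂ C : ℕ} (ψ : (Fin k₁ → ℝ) → (Fin k₂ → ℝ) → Fin C → ℝ)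
    (b : Fin k₂) (v : Fin k₁ → ℝ) (w : Fin k₂ → ℝ) (y : Fin C) : ℝ :=
  fderiv ℝ (fun w' => ψ v w' y) w (Pi.single b 1)

/-- The function class `F_q` with constant `K` on `ℝ^n`. -/
def MemFq {n : ℕ} (q K : ℝ) (f : (Fin n → ℝ) → ℝ) : Prop :=
  ContDiff ℝ 3 f ∧ ∀ i : ℕ, i ≤ 3 → ∀ x, ‖iteratedFDeriv ℝ i f x‖ ≤ K * (1 + ‖x‖ ^ q)

/-- Assumption A for a projective model with link `ψ` and noise distribution `ν`:
there is `q ≥ 1` such that `ν` has `max{20q+4, q²+4}` finite moments and the partial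
derivatives of `ψ` lie in `F_q` uniformly over `w` in balls and over labels. -/
def AssumptionA {k₁ k₂ C : ℕ} (q : ℝ)
    (ψ : (Fin k₁ → ℝ) → (Fin k₂ → ℝ) → Fin C → ℝ) (ν : Measure ℝ) : Prop :=
  1 ≤ q ∧
  Integrable (fun x : ℝ => |x| ^ (max (20 * q + 4) (q ^ 2 + 4))) ν ∧
  ∀ R : ℝ, 0 < R → ∃ K : ℝ,
    ∀ w : Fin k₂ → ℝ, ‖w‖ ≤ R → ∀ y : Fin C,
      (∀ a, MemFq q K (fun v => d1 ψ a v w y)) ∧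
      (∀ b, MemFq q K (fun v => d2 ψ b v w y))

/-- Mixture expectation for the `ν`-mixture model with weights `p` and means `μ`:
`E[F(J, X)] = ∑_a p_a ∫ F(a, μ^a + y) dν^{⊗d}(y)`. -/
noncomputable def mixE {k d : ℕ} (p : Fin k → ℝ) (μ : Fin k → Fin d → ℝ) (ν : Measure ℝ)
    (F : Fin k → (Fin d → ℝ) → ℝ) : ℝ :=
  ∑ a, p a * ∫ y, F a (fun i => μ a i + y i) ∂(Measure.pi fun _ : Fin d => ν)

/-- The projections `θᵀx ∈ ℝ^{k₁}`. -/
noncomputable def projv {k₁ d : ℕ} (θ : Fin k₁ → Fin d → ℝ) (x : Fin d → ℝ) :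
    Fin k₁ → ℝ := fun a => ∑ i, θ a i * x i

/-- Squared Euclidean norm of a vector in `ℝ^d`. -/
noncomputable def n2sq {d : ℕ} (v : Fin d → ℝ) : ℝ := ∑ i, (v i) ^ 2

/-- The cubed `ℓ³` norm of a vector in `ℝ^d`. -/
noncomputable def n3cube {d : ℕ} (v : Fin d → ℝ) : ℝ := ∑ i, |v i| ^ 3

/-- The coordinate-delocalization condition: `|vᵢ| ≤ d^{-1/2+ζ}` for all `i`. -/
def Deloc (ζ : ℝ) {d : ℕ} (v : Fin d → ℝ) : Prop :=
  ∀ i, |v i| ≤ (d : ℝ) ^ (-(1 / 2 : ℝ) + ζ)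



/-- Growth class on a normed space. -/
def Gr {E : Type*} [NormedAddCommGroup E] [NormedSpace ℝ E] (r K : ℝ) (f : E → ℝ) : Prop :=
  ContDiff ℝ 3 f ∧ ∀ i : ℕ, i ≤ 3 → ∀ x, ‖iteratedFDeriv ℝ i f x‖ ≤ K * (1 + ‖x‖) ^ r

section Growth
variable {E : Type*} [NormedAddCommGroup E] [NormedSpace ℝ E]

lemma Gr.nonneg {r K : ℝ} {f : E → ℝ} (h : Gr r K f) : 0 ≤ K := by
  have := (norm_nonneg _).trans (h.2 0 (by norm_num) 0)
  simpa using this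

lemma Gr.mono {r s K L : ℝ} {f : E → ℝ} (h : Gr r K f) (hrs : r ≤ s) (hKL : K ≤ L) :
    Gr s L f := by
  refine ⟨h.1, fun i hi x => (h.2 i hi x).trans ?_⟩
  have h1 : (1 : ℝ) ≤ 1 + ‖x‖ := by linarith [norm_nonneg x]
  have hL : 0 ≤ L := h.nonneg.trans hKL
  gcongr

lemma Gr.mul {r s K L : ℝ} {f g : E → ℝ} (hf : Gr r K f) (hg : Gr s L g) :
    Gr (r + s) (8 * (K * L)) (fun x => f x * g x) := by
  refine ⟨hf.1.mul hg.1, fun n hn x => ?_⟩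
  have h0 : (0 : ℝ) < 1 + ‖x‖ := by linarith [norm_nonneg x]
  have hK := hf.nonneg
  have hL := hg.nonneg
  refine (norm_iteratedFDeriv_mul_le hf.1 hg.1 x (n := n) (by exact_mod_cast hn)).trans ?_
  have : ∀ i ∈ Finset.range (n + 1),
      (n.choose i : ℝ) * ‖iteratedFDeriv ℝ i f x‖ * ‖iteratedFDeriv ℝ (n - i) g x‖ ≤
      (n.choose i : ℝ) * ((K * (1 + ‖x‖) ^ r) * (L * (1 + ‖x‖) ^ s)) := by
    intro i hi
    rw [Finset.mem_range] at hi
    rw [mul_assoc]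
    gcongr
    · exact hf.2 i (by omega) x
    · exact hg.2 _ (by omega) x
  refine (Finset.sum_le_sum this).trans ?_
  rw [← Finset.sum_mul, ← Nat.cast_sum, Nat.sum_range_choose]
  rw [Real.rpow_add h0]
  have h8 : ((2 ^ n : ℕ) : ℝ) ≤ 8 := by
    have : 2 ^ n ≤ 2 ^ 3 := Nat.pow_le_pow_right (by norm_num) hn
    exact_mod_cast this
  calc _ ≤ 8 * ((K * (1 + ‖x‖) ^ r) * (L * (1 + ‖x‖) ^ s)) := by gcongr
    _ = _ := by ring

lemma Gr.one : Gr 0 1 (fun _ : E => (1 : ℝ)) := by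
  refine ⟨contDiff_const, fun n hn x => ?_⟩
  rcases Nat.eq_zero_or_pos n with rfl | h
  · simp
  · rw [iteratedFDeriv_const_of_ne (by omega)]
    simp

lemma Gr.pow {r K : ℝ} {f : E → ℝ} (hf : Gr r K f) (n : ℕ) :
    Gr (n * r) ((8 * K) ^ n) (fun x => f x ^ n) := by
  induction n with
  | zero => simpa using Gr.one (E := E)
  | succ n ih =>
    have := ih.mul hf
    simp only [pow_succ]
    refine this.mono (le_of_eq (by push_cast; ring)) (le_of_eq (by ring))

lemma Gr.lin (g : E →L[ℝ] ℝ) : Gr 1 ‖g‖ (fun x => g x) := by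
  refine ⟨g.contDiff, fun n hn x => ?_⟩
  rw [Real.rpow_one]
  have hx := norm_nonneg x
  have hg := norm_nonneg g
  rcases n with _ | n
  · rw [norm_iteratedFDeriv_zero]
    refine (g.le_opNorm x).trans ?_
    gcongr; linarith
  · rw [← norm_iteratedFDeriv_fderiv]
    have : fderiv ℝ (fun x => g x) = fun _ => g := by ext1 y; exact g.fderiv
    rw [this]
    rcases n with _ | n
    · rw [norm_iteratedFDeriv_zero]; nlinarith
    · rw [iteratedFDeriv_const_of_ne (by omega)]
      simp; positivity

lemma Gr.comp {F : Type*} [NormedAddCommGroup F] [NormedSpace ℝ F] {r K : ℝ} {f : E → ℝ}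
    (hr : 0 ≤ r)
    (hf : Gr r K f) (L : F →L[ℝ] E) (hL : ‖L‖ ≤ 1) : Gr r K (fun x => f (L x)) := by
  refine ⟨hf.1.comp L.contDiff, fun n hn x => ?_⟩
  have hK := hf.nonneg
  have h1 := L.iteratedFDeriv_comp_right hf.1 x (i := n) (by exact_mod_cast hn)
  change ‖iteratedFDeriv ℝ n (f ∘ L) x‖ ≤ _
  rw [h1]
  refine (ContinuousMultilinearMap.norm_compContinuousLinearMap_le _ _).trans ?_
  have h2 : ∏ i : Fin n, ‖L‖ ≤ 1 := Finset.prod_le_one (by simp) (by simp [hL])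
  have h3 : ‖L x‖ ≤ ‖x‖ := by
    refine (L.le_opNorm x).trans ?_
    nlinarith [norm_nonneg x]
  calc _ ≤ ‖iteratedFDeriv ℝ n f (L x)‖ * 1 := by gcongr
    _ ≤ K * (1 + ‖L x‖) ^ r := by rw [mul_one]; exact hf.2 n hn _
    _ ≤ _ := by gcongr

end Growth
/-- Centered, normalized probability measures with `N + 3` finite moments. -/
structure Good (N : ℕ) (ν : Measure ℝ) : Prop where
  prob : IsProbabilityMeasure ν
  mean : ∫ x, x ∂ν = 0
  var : ∫ x, x ^ 2 ∂ν = 1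
  mem : MemLp (fun x : ℝ => x) ((N + 3 : ℕ) : ENNReal) ν

lemma Good.memLp {N : ℕ} {ν : Measure ℝ} (h : Good N ν) {l : ℕ} (hl : l ≤ N + 3) :
    MemLp (fun x : ℝ => x) (l : ENNReal) ν := by
  have := h.prob
  exact h.mem.mono_exponent (by exact_mod_cast hl)

lemma Good.int_abs {N : ℕ} {ν : Measure ℝ} (h : Good N ν) {l : ℕ} (hl : l ≤ N + 3) :
    Integrable (fun x : ℝ => |x| ^ l) ν := by
  have := h.prob
  simpa using (h.memLp hl).integrable_norm_pow'

lemma Good.int_pow {N : ℕ} {ν : Measure ℝ} (h : Good N ν) {l : ℕ} (hl : l ≤ N + 3) :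
    Integrable (fun x : ℝ => x ^ l) ν := by
  refine (h.int_abs hl).mono' (by fun_prop) ?_
  filter_upwards with x
  simp

lemma weight1 {N : ℕ} {ν : Measure ℝ} (h : Good N ν) {n : ℕ} (hn : n ≤ N + 3) (hev : Even n)
    (B : ℝ) : ∃ K : ℝ, 0 ≤ K ∧ ∀ x a : ℝ, |a| ≤ B →
      ∫ y, (x + y * a) ^ n ∂ν ≤ x ^ n + K * a ^ 2 * (1 + x ^ n) := by
  have := h.prob
  set B' := max 1 B with hB'
  have hB1 : 1 ≤ B' := le_max_left _ _
  refine ⟨∑ l ∈ Finset.range (n + 1), (n.choose l : ℝ) * B' ^ n * ∫ y, |y| ^ (n - l) ∂ν,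
    Finset.sum_nonneg fun l _ => by positivity, fun x a ha => ?_⟩
  have haB : |a| ≤ B' := ha.trans (le_max_right _ _)
  have hxn : 0 ≤ x ^ n := hev.pow_nonneg x
  have e1 : ∀ y : ℝ, (x + y * a) ^ n =
      ∑ l ∈ Finset.range (n + 1), (x ^ l * a ^ (n - l) * n.choose l) * y ^ (n - l) := by
    intro y
    rw [add_pow]
    refine Finset.sum_congr rfl fun l _ => ?_
    rw [mul_pow]; ring
  simp_rw [e1]
  rw [integral_finsetSum _ fun l _ => (h.int_pow (by omega)).const_mul _]
  simp_rw [integral_const_mul]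
  rw [Finset.sum_mul, Finset.sum_mul]
  have e2 : x ^ n = ∑ l ∈ Finset.range (n + 1), if l = n then x ^ n else 0 := by
    simp
  conv_rhs => rw [e2]
  rw [← Finset.sum_add_distrib, ← e2]
  refine Finset.sum_le_sum fun l hl => ?_
  rw [Finset.mem_range] at hl
  have hpos : 0 ≤ ∫ y, |y| ^ (n - l) ∂ν := integral_nonneg fun y => by positivity
  have hpos2 : 0 ≤ (n.choose l : ℝ) * B' ^ n * (∫ y, |y| ^ (n - l) ∂ν) * a ^ 2 * (1 + x ^ n) := by
    positivity
  obtain rfl | hln | hln : l = n ∨ l + 1 = n ∨ l + 2 ≤ n := by omega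
  · simp only [Nat.sub_self, pow_zero, Nat.choose_self, if_true] at hpos2 ⊢
    simp only [Nat.cast_one, mul_one, integral_const, probReal_univ, smul_eq_mul] at hpos2 ⊢
    linarith
  · have : n - l = 1 := by omega
    simp only [this, pow_one] at hpos2 ⊢
    rw [h.mean, mul_zero, if_neg (by omega)]
    linarith
  · rw [if_neg (by omega), zero_add]
    have h1 : |∫ y, y ^ (n - l) ∂ν| ≤ ∫ y, |y| ^ (n - l) ∂ν := by
      refine (abs_integral_le_integral_abs).trans (le_of_eq ?_)
      simp_rw [abs_pow]
    have h2 : |x| ^ l ≤ 1 + x ^ n := by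
      rw [← hev.pow_abs x]
      rcases le_total |x| 1 with hx | hx
      · have := pow_le_one₀ (n := l) (abs_nonneg x) hx
        have : 0 ≤ |x| ^ n := by positivity
        linarith
      · have := pow_le_pow_right₀ hx (show l ≤ n by omega)
        linarith
    have h3 : |a| ^ (n - l) ≤ a ^ 2 * B' ^ n := by
      have : n - l = 2 + (n - l - 2) := by omega
      rw [this, pow_add, sq_abs]
      gcongr
      calc |a| ^ (n - l - 2) ≤ B' ^ (n - l - 2) := by gcongr
        _ ≤ B' ^ n := pow_le_pow_right₀ hB1 (by omega)
    calc _ ≤ |x ^ l * a ^ (n - l) * (n.choose l) * ∫ y, y ^ (n - l) ∂ν| := le_abs_self _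
      _ = |x| ^ l * |a| ^ (n - l) * (n.choose l) * |∫ y, y ^ (n - l) ∂ν| := by
        simp [abs_mul, abs_pow]
      _ ≤ (1 + x ^ n) * (a ^ 2 * B' ^ n) * (n.choose l) * ∫ y, |y| ^ (n - l) ∂ν := by gcongr
      _ = _ := by ring

/-- Polynomial weight. -/
noncomputable def Wt {ι : Type*} [Fintype ι] (n : ℕ) (z : ι → ℝ) : ℝ := 1 + ∑ c, z c ^ n

lemma Wt_cont {ι : Type*} [Fintype ι] (n : ℕ) : Continuous (Wt (ι := ι) n) := by
  unfold Wt; fun_prop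

lemma Wt_one_le {ι : Type*} [Fintype ι] {n : ℕ} (hev : Even n) (z : ι → ℝ) : 1 ≤ Wt n z := by
  have : 0 ≤ ∑ c, z c ^ n := Finset.sum_nonneg fun c _ => hev.pow_nonneg _
  unfold Wt; linarith

lemma intble {ι Ω : Type*} [Fintype ι] [MeasurableSpace Ω] (P : Measure Ω) [IsFiniteMeasure P]
    {n : ℕ} (hev : Even n) (X : Ω → ι → ℝ) (hXm : Measurable X)
    (hX : ∀ c, MemLp (fun ω => X ω c) (n : ENNReal) P)
    (f : (ι → ℝ) → ℝ) (hf : Continuous f) (c : ℝ) (hfc : ∀ z, |f z| ≤ c * Wt n z) :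
    Integrable (fun ω => f (X ω)) P := by
  refine Integrable.mono' (g := fun ω => c * Wt n (X ω)) ?_
    (hf.measurable.comp hXm).aestronglyMeasurable ?_
  · refine Integrable.const_mul ?_ _
    unfold Wt
    refine (integrable_const _).add (integrable_finsetSum _ fun c _ => ?_)
    have := (hX c).integrable_norm_pow'
    simpa [hev.pow_abs] using this
  · filter_upwards with ω
    exact hfc _

lemma memLp_add' {Ω : Type*} [MeasurableSpace Ω] {P : Measure Ω} {p : ENNReal} {f g : Ω → ℝ}
    (hf : MemLp f p P) (hg : MemLp g p P) : MemLp (fun ω => f ω + g ω) p P := hf.add hg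

lemma memLp_const' {Ω : Type*} [MeasurableSpace Ω] {P : Measure Ω} [IsFiniteMeasure P]
    {p : ENNReal} (a : ℝ) : MemLp (fun _ : Ω => a) p P := memLp_const a

lemma memLp_mulc {Ω : Type*} [MeasurableSpace Ω] {P : Measure Ω} {p : ENNReal} {f : Ω → ℝ}
    (hf : MemLp f p P) (a : ℝ) : MemLp (fun ω => f ω * a) p P := hf.mul_const a

lemma memLp_sum' {Ω ι : Type*} [Fintype ι] [MeasurableSpace Ω] {P : Measure Ω} {p : ENNReal}
    {f : ι → Ω → ℝ}
    (hf : ∀ i, MemLp (f i) p P) : MemLp (fun ω => ∑ i, f i ω) p P :=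
  memLp_finsetSum _ fun i _ => hf i

lemma intble1 {ι : Type*} [Fintype ι] {N : ℕ} {ν : Measure ℝ} (h : Good N ν) {n : ℕ}
    (hn : n ≤ N + 3) (hev : Even n) 
    (f : (ι → ℝ) → ℝ) (hf : Continuous f) (c : ℝ) (hfc : ∀ z, |f z| ≤ c * Wt n z)
    (z v : ι → ℝ) : Integrable (fun y : ℝ => f (z + y • v)) ν := by
  have := h.prob
  refine intble ν hev (fun y : ℝ => z + y • v) (by fun_prop) (fun c => ?_) f hf c hfc
  simp only [Pi.add_apply, Pi.smul_apply, smul_eq_mul]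
  exact memLp_add' (memLp_const' _) (memLp_mulc (h.memLp hn) _)

lemma intbleD {ι : Type*} [Fintype ι] {N : ℕ} {ν : Measure ℝ} [IsProbabilityMeasure ν]
    (h : Good N ν) {n : ℕ}
    (hn : n ≤ N + 3) (hev : Even n) 
    (f : (ι → ℝ) → ℝ) (hf : Continuous f) (c : ℝ) (hfc : ∀ z, |f z| ≤ c * Wt n z)
    (d : ℕ) (s : ι → ℝ) (V : Fin d → ι → ℝ) :
    Integrable (fun y : Fin d → ℝ => f (s + ∑ i, y i • V i)) (Measure.pi fun _ : Fin d => ν) := by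
  refine intble _ hev (fun y : Fin d → ℝ => s + ∑ i, y i • V i) (by fun_prop) (fun c => ?_)
    f hf c hfc
  simp only [Pi.add_apply, Finset.sum_apply, Pi.smul_apply, smul_eq_mul]
  refine memLp_add' (memLp_const' _) (memLp_sum' fun i => memLp_mulc ?_ _)
  exact (h.memLp hn).comp_measurePreserving (measurePreserving_eval (fun _ : Fin d => ν) i)

lemma weight {ι : Type*} [Fintype ι] {N : ℕ} {ν : Measure ℝ} (h : Good N ν) {n : ℕ}
    (hn : n ≤ N + 3) (hev : Even n)
    (B : ℝ) : ∃ K : ℝ, 0 ≤ K ∧ ∀ z v : ι → ℝ, ‖v‖ ≤ B →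
      ∫ y : ℝ, Wt n (z + y • v) ∂ν ≤ (1 + K * ‖v‖ ^ 2) * Wt n z := by
  have := h.prob
  obtain ⟨K, hK, hw⟩ := weight1 h hn hev B
  refine ⟨K * (Fintype.card ι + 1), by positivity, fun z v hv => ?_⟩
  have hi : ∀ c, Integrable (fun y : ℝ => (z c + y * v c) ^ n) ν := fun c => by
    have := ((memLp_const (z c)).add ((h.memLp hn).mul_const (v c))).integrable_norm_pow'
    simpa [hev.pow_abs] using this
  have hvc : ∀ c, |v c| ≤ ‖v‖ := fun c => norm_le_pi_norm v c
  unfold Wt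
  simp only [Pi.add_apply, Pi.smul_apply, smul_eq_mul]
  rw [integral_add (integrable_const _) (integrable_finsetSum _ fun c _ => hi c),
    integral_finsetSum _ fun c _ => hi c]
  simp only [integral_const, probReal_univ, smul_eq_mul, mul_one]
  have h1 : ∑ c, ∫ y, (z c + y * v c) ^ n ∂ν ≤
      ∑ c, (z c ^ n + K * ‖v‖ ^ 2 * (1 + z c ^ n)) := by
    refine Finset.sum_le_sum fun c _ => (hw _ _ ((hvc c).trans hv)).trans ?_
    have : 0 ≤ z c ^ n := hev.pow_nonneg _
    have : v c ^ 2 ≤ ‖v‖ ^ 2 := by rw [← sq_abs]; gcongr; exact hvc c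
    gcongr
  have h2 : ∑ c, (z c ^ n + K * ‖v‖ ^ 2 * (1 + z c ^ n)) =
      ∑ c, z c ^ n + K * ‖v‖ ^ 2 * (Fintype.card ι + ∑ c, z c ^ n) := by
    rw [Finset.sum_add_distrib, ← Finset.mul_sum, Finset.sum_add_distrib]
    simp
  have h3 : 0 ≤ ∑ c, z c ^ n := Finset.sum_nonneg fun c _ => hev.pow_nonneg _
  have h4 : (0:ℝ) ≤ Fintype.card ι := by positivity
  have h5 : 0 ≤ K * ‖v‖ ^ 2 := by positivity
  have h6 : (Fintype.card ι + ∑ c, z c ^ n) ≤ (Fintype.card ι + 1) * (1 + ∑ c, z c ^ n) := by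
    nlinarith
  have h7 := mul_le_mul_of_nonneg_left h6 h5
  linarith

lemma int_succ {ι : Type*} [Fintype ι] {N : ℕ} {ν : Measure ℝ} [IsProbabilityMeasure ν]
    (h : Good N ν) {n : ℕ} (hn : n ≤ N + 3) (hev : Even n) 
    (f : (ι → ℝ) → ℝ) (hf : Continuous f) (c : ℝ) (hfc : ∀ z, |f z| ≤ c * Wt n z)
    (d : ℕ) (s : ι → ℝ) (V : Fin (d + 1) → ι → ℝ) :
    Integrable (fun p : ℝ × (Fin d → ℝ) => f (s + p.1 • V 0 + ∑ i, p.2 i • V i.succ))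
      (ν.prod (Measure.pi fun _ : Fin d => ν)) ∧
    ∫ y : Fin (d + 1) → ℝ, f (s + ∑ i, y i • V i) ∂(Measure.pi fun _ : Fin (d + 1) => ν) =
    ∫ p : ℝ × (Fin d → ℝ), f (s + p.1 • V 0 + ∑ i, p.2 i • V i.succ)
      ∂(ν.prod (Measure.pi fun _ : Fin d => ν)) := by
  have mp := (measurePreserving_piFinSuccAbove (fun _ : Fin (d + 1) => ν) 0)
  have hi := intbleD h hn hev f hf c hfc (d + 1) s V
  have e : (fun y : Fin (d + 1) → ℝ => f (s + ∑ i, y i • V i)) =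
    (fun p : ℝ × (Fin d → ℝ) => f (s + p.1 • V 0 + ∑ i, p.2 i • V i.succ)) ∘
      (MeasurableEquiv.piFinSuccAbove (fun _ : Fin (d + 1) => ℝ) 0) := by
    ext y
    simp only [Function.comp, MeasurableEquiv.piFinSuccAbove_apply, Fin.insertNthEquiv_zero,
      Fin.sum_univ_succ, add_assoc]
    rfl
  constructor
  · rw [e] at hi
    exact (mp.integrable_comp_emb (MeasurableEquiv.measurableEmbedding _)).1 hi
  · rw [← mp.integral_comp']
    exact congrArg (fun g => ∫ y, g y ∂(Measure.pi fun _ : Fin (d + 1) => ν)) e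

set_option maxHeartbeats 400000 in
lemma weightD {ι : Type*} [Fintype ι] {N : ℕ} {ν : Measure ℝ} [IsProbabilityMeasure ν]
    (h : Good N ν) {n : ℕ} (hn : n ≤ N + 3) (hev : Even n) {B K : ℝ} (hK : 0 ≤ K)
    (hw : ∀ z v : ι → ℝ, ‖v‖ ≤ B →
      ∫ y : ℝ, Wt n (z + y • v) ∂ν ≤ (1 + K * ‖v‖ ^ 2) * Wt n z) (d : ℕ) :
    ∀ (s : ι → ℝ) (V : Fin d → ι → ℝ), (∀ i, ‖V i‖ ≤ B) →
    ∫ y : Fin d → ℝ, Wt n (s + ∑ i, y i • V i) ∂(Measure.pi fun _ : Fin d => ν) ≤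
      Real.exp (K * ∑ i, ‖V i‖ ^ 2) * Wt n s := by
  have hb : ∀ z : ι → ℝ, |Wt n z| ≤ 1 * Wt n z := fun z => by
    rw [abs_of_nonneg (by linarith [Wt_one_le hev z]), one_mul]
  induction d with
  | zero => intro s V hV; simp
  | succ d ih =>
    intro s V hV
    obtain ⟨hi, he⟩ := int_succ h hn hev (Wt n) (Wt_cont n) 1 hb d s V
    rw [he, integral_prod _ hi]
    have h1 : ∫ y : ℝ, ∫ y' : Fin d → ℝ, Wt n (s + y • V 0 + ∑ i, y' i • V i.succ)
        ∂(Measure.pi fun _ : Fin d => ν) ∂ν ≤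
        ∫ y : ℝ, Real.exp (K * ∑ i : Fin d, ‖V i.succ‖ ^ 2) * Wt n (s + y • V 0) ∂ν := by
      refine integral_mono hi.integral_prod_left
        ((intble1 h hn hev (Wt n) (Wt_cont n) 1 hb s (V 0)).const_mul _) fun y => ?_
      exact ih _ (fun i => V i.succ) fun i => hV _
    refine h1.trans ?_
    rw [integral_const_mul, Fin.sum_univ_succ, mul_add, Real.exp_add,
      mul_comm (Real.exp (K * ‖V 0‖ ^ 2)), mul_assoc]
    gcongr
    refine (hw s (V 0) (hV 0)).trans ?_
    have := Wt_one_le hev s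
    gcongr
    linarith [Real.add_one_le_exp (K * ‖V 0‖ ^ 2)]

set_option maxHeartbeats 1000000 in
lemma lindeberg {ι : Type*} [Fintype ι] {N : ℕ} {ν γ : Measure ℝ} [IsProbabilityMeasure ν]
    [IsProbabilityMeasure γ]
    (hν : Good N ν) (hγ : Good N γ) {n : ℕ} (hn : n ≤ N + 3) (hev : Even n) {B K : ℝ} (hK : 0 ≤ K)
    (hwν : ∀ z v : ι → ℝ, ‖v‖ ≤ B →
      ∫ y : ℝ, Wt n (z + y • v) ∂ν ≤ (1 + K * ‖v‖ ^ 2) * Wt n z)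
    (hwγ : ∀ z v : ι → ℝ, ‖v‖ ≤ B →
      ∫ y : ℝ, Wt n (z + y • v) ∂γ ≤ (1 + K * ‖v‖ ^ 2) * Wt n z)
    (f : (ι → ℝ) → ℝ) (hf : Continuous f) (c : ℝ) (hfc : ∀ z, |f z| ≤ c * Wt n z)
    {A : ℝ} (hA : 0 ≤ A)
    (hstep : ∀ z v : ι → ℝ, ‖v‖ ≤ B →
      |∫ y : ℝ, f (z + y • v) ∂ν - ∫ y : ℝ, f (z + y • v) ∂γ| ≤ A * ‖v‖ ^ 3 * Wt n z)
    (d : ℕ) :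
    ∀ (s : ι → ℝ) (V : Fin d → ι → ℝ), (∀ i, ‖V i‖ ≤ B) →
    |∫ y : Fin d → ℝ, f (s + ∑ i, y i • V i) ∂(Measure.pi fun _ : Fin d => ν) -
      ∫ y : Fin d → ℝ, f (s + ∑ i, y i • V i) ∂(Measure.pi fun _ : Fin d => γ)| ≤
      A * (∑ i, ‖V i‖ ^ 3) * Real.exp (K * ∑ i, ‖V i‖ ^ 2) * Wt n s := by
  have hb : ∀ z : ι → ℝ, |Wt n z| ≤ 1 * Wt n z := fun z => by
    rw [abs_of_nonneg (by linarith [Wt_one_le hev z]), one_mul]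
  induction d with
  | zero => intro s V hV; simp
  | succ d ih =>
    intro s V hV
    obtain ⟨hi, he⟩ := int_succ hν hn hev f hf c hfc d s V
    obtain ⟨hi', he'⟩ := int_succ hγ hn hev f hf c hfc d s V
    rw [he, he', integral_prod _ hi, integral_prod_symm _ hi']
    simp only
    set S2 := ∑ i : Fin d, ‖V i.succ‖ ^ 2 with hS2
    set S3 := ∑ i : Fin d, ‖V i.succ‖ ^ 3 with hS3
    have hS3n : 0 ≤ S3 := by positivity
    have hWs := Wt_one_le hev s
    -- the intermediate hybrid
    set G : ℝ → ℝ := fun y => ∫ y' : Fin d → ℝ, f (s + y • V 0 + ∑ i, y' i • V i.succ)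
        ∂(Measure.pi fun _ : Fin d => γ) with hG
    set H : (Fin d → ℝ) → ℝ := fun y' => ∫ y : ℝ, f (s + y • V 0 + ∑ i, y' i • V i.succ) ∂ν
      with hH
    have hXY : Integrable (fun p : ℝ × (Fin d → ℝ) => f (s + p.1 • V 0 + ∑ i, p.2 i • V i.succ))
      (ν.prod (Measure.pi fun _ : Fin d => γ)) := by
      refine intble _ hev (fun p : ℝ × (Fin d → ℝ) => s + p.1 • V 0 + ∑ i, p.2 i • V i.succ)
        (by fun_prop) (fun c => ?_) f hf c hfc
      simp only [Pi.add_apply, Finset.sum_apply, Pi.smul_apply, smul_eq_mul]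
      refine memLp_add' (memLp_add' (memLp_const' _) (memLp_mulc ?_ _))
        (memLp_sum' fun i => memLp_mulc ?_ _)
      · exact (hν.memLp hn).comp_measurePreserving measurePreserving_fst
      · exact ((hγ.memLp hn).comp_measurePreserving
          (measurePreserving_eval (fun _ : Fin d => γ) i)).comp_measurePreserving
          measurePreserving_snd
    have hmid : ∫ y, G y ∂ν = ∫ y', H y' ∂(Measure.pi fun _ : Fin d => γ) := by
      rw [hG, hH]
      rw [← integral_prod _ hXY, ← integral_prod_symm _ hXY]
    have b1 : |∫ y : ℝ, (∫ y' : Fin d → ℝ, f (s + y • V 0 + ∑ i, y' i • V i.succ)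
        ∂(Measure.pi fun _ : Fin d => ν)) ∂ν - ∫ y, G y ∂ν| ≤
        A * S3 * Real.exp (K * S2) * (Real.exp (K * ‖V 0‖ ^ 2) * Wt n s) := by
      rw [← integral_sub hi.integral_prod_left hXY.integral_prod_left]
      refine abs_integral_le_integral_abs.trans ?_
      have : ∫ y : ℝ, |(∫ y' : Fin d → ℝ, f (s + y • V 0 + ∑ i, y' i • V i.succ)
        ∂(Measure.pi fun _ : Fin d => ν)) - G y| ∂ν ≤
          ∫ y : ℝ, A * S3 * Real.exp (K * S2) * Wt n (s + y • V 0) ∂ν := by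
        refine integral_mono (hi.integral_prod_left.sub hXY.integral_prod_left).abs
          ((intble1 hν hn hev (Wt n) (Wt_cont n) 1 hb s (V 0)).const_mul _) fun y => ?_
        exact ih _ (fun i => V i.succ) fun i => hV _
      refine this.trans ?_
      rw [integral_const_mul]
      gcongr
      refine (hwν s (V 0) (hV 0)).trans ?_
      gcongr
      linarith [Real.add_one_le_exp (K * ‖V 0‖ ^ 2)]
    have b2 : |∫ y', H y' ∂(Measure.pi fun _ : Fin d => γ) - 
        ∫ y' : Fin d → ℝ, (∫ y : ℝ, f (s + y • V 0 + ∑ i, y' i • V i.succ) ∂γ)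
          ∂(Measure.pi fun _ : Fin d => γ)| ≤ A * ‖V 0‖ ^ 3 * (Real.exp (K * S2) * Wt n s) := by
      rw [← integral_sub hXY.integral_prod_right hi'.integral_prod_right]
      refine abs_integral_le_integral_abs.trans ?_
      have : ∫ y' : Fin d → ℝ, |H y' - ∫ y : ℝ, f (s + y • V 0 + ∑ i, y' i • V i.succ) ∂γ|
          ∂(Measure.pi fun _ : Fin d => γ) ≤
          ∫ y' : Fin d → ℝ, A * ‖V 0‖ ^ 3 * Wt n (s + ∑ i, y' i • V i.succ)
          ∂(Measure.pi fun _ : Fin d => γ) := by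
        refine integral_mono (hXY.integral_prod_right.sub hi'.integral_prod_right).abs
          ((intbleD hγ hn hev (Wt n) (Wt_cont n) 1 hb d s (fun i => V i.succ)).const_mul _)
          fun y' => ?_
        have := hstep (s + ∑ i, y' i • V i.succ) (V 0) (hV 0)
        simp only [hH]
        simp only [add_right_comm s (∑ i, y' i • V i.succ)] at this
        exact this
      refine this.trans ?_
      rw [integral_const_mul]
      gcongr
      exact weightD hγ hn hev hK hwγ d s (fun i => V i.succ) fun i => hV _
    have hexp : 1 ≤ Real.exp (K * ‖V 0‖ ^ 2) := Real.one_le_exp (by positivity)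
    rw [Fin.sum_univ_succ, Fin.sum_univ_succ, mul_add K, Real.exp_add]
    have htri := abs_sub_le (∫ y : ℝ, (∫ y' : Fin d → ℝ, f (s + y • V 0 + ∑ i, y' i • V i.succ)
        ∂(Measure.pi fun _ : Fin d => ν)) ∂ν) (∫ y, G y ∂ν) 
        (∫ y' : Fin d → ℝ, (∫ y : ℝ, f (s + y • V 0 + ∑ i, y' i • V i.succ) ∂γ)
          ∂(Measure.pi fun _ : Fin d => γ))
    rw [← hmid] at b2
    have b3 : A * ‖V 0‖ ^ 3 * (Real.exp (K * S2) * Wt n s) ≤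
      A * ‖V 0‖ ^ 3 * (Real.exp (K * S2) * Wt n s) * Real.exp (K * ‖V 0‖ ^ 2) :=
      le_mul_of_one_le_right (by positivity) hexp
    calc _ ≤ _ := htri.trans (add_le_add b1 (b2.trans b3))
      _ = _ := by ring

lemma gr_wt {ι : Type*} [Fintype ι] {N n : ℕ} (hNn : N ≤ n) (hev : Even n) (z : ι → ℝ) :
    (1 + ‖z‖) ^ N ≤ 2 ^ n * Wt n z := by
  have hz := norm_nonneg z
  have h1 : (1 + ‖z‖) ^ N ≤ (1 + ‖z‖) ^ n := pow_le_pow_right₀ (by linarith) hNn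
  have h2 := add_pow_le (zero_le_one (α := ℝ)) hz n
  have hsum : 0 ≤ ∑ c, z c ^ n := Finset.sum_nonneg fun c _ => hev.pow_nonneg _
  have h3 : 1 ^ n + ‖z‖ ^ n ≤ 2 * Wt n z := by
    unfold Wt
    rcases isEmpty_or_nonempty ι with he | he
    · have : z = 0 := Subsingleton.elim _ _
      subst this
      rcases Nat.eq_zero_or_pos n with h | h
      · subst h; norm_num
      · simp [zero_pow (by omega : n ≠ 0)]
    · obtain ⟨c, hc⟩ : ∃ c, ‖z‖ = |z c| := by
        obtain ⟨c, hc⟩ := Finite.exists_max (fun c => |z c|)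
        refine ⟨c, le_antisymm ((pi_norm_le_iff_of_nonempty z).2 hc) (norm_le_pi_norm z c)⟩
      have := Finset.single_le_sum (f := fun c => z c ^ n) (fun c _ => hev.pow_nonneg _)
        (Finset.mem_univ c)
      rw [hc, hev.pow_abs, one_pow]
      linarith
  have hW := Wt_one_le hev z
  rcases Nat.eq_zero_or_pos n with h | h
  · subst h
    have : N = 0 := by omega
    subst this
    simp; linarith
  · calc _ ≤ _ := h1
      _ ≤ _ := h2
      _ ≤ 2 ^ (n - 1) * (2 * Wt n z) := by gcongr
      _ = 2 ^ (n - 1 + 1) * Wt n z := by ring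
      _ = _ := by rw [Nat.sub_add_cancel h]

lemma taylor_pt {E : Type*} [NormedAddCommGroup E] [NormedSpace ℝ E] {N : ℕ} {K B : ℝ}
    {f : E → ℝ} (hf : Gr N K f) (z v : E) (hv : ‖v‖ ≤ B) (y : ℝ) :
    |f (z + y • v) - (f z + y * iteratedFDeriv ℝ 1 f z (fun _ => v)
      + y ^ 2 * (iteratedFDeriv ℝ 2 f z (fun _ => v) / 2))| ≤
      (K * ‖v‖ ^ 3 * (1 + ‖z‖) ^ N) * (|y| ^ 3 * (1 + B * |y|) ^ N) := by
  have hK := hf.nonneg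
  have hB : 0 ≤ B := (norm_nonneg v).trans hv
  have hT := map_add_eq_sum_add_integral_iteratedFDeriv (f := f) (x := z) (y := y • v) (n := 2)
    (fun t _ => hf.1.contDiffAt.of_le (by norm_num))
  have hsm : ∀ k (x : E), iteratedFDeriv ℝ k f x (fun _ => y • v) =
      y ^ k * iteratedFDeriv ℝ k f x (fun _ => v) := by
    intro k x
    rw [(iteratedFDeriv ℝ k f x).map_smul_univ (fun _ => y) (fun _ => v)]
    simp
  simp only [hsm, Finset.sum_range_succ, Finset.sum_range_zero, smul_eq_mul] at hT
  have hT' : f (z + y • v) - (f z + y * iteratedFDeriv ℝ 1 f z (fun _ => v)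
      + y ^ 2 * (iteratedFDeriv ℝ 2 f z (fun _ => v) / 2)) =
      2⁻¹ * ∫ t in (0:ℝ)..1, (1 - t) ^ 2 *
        (y ^ 3 * iteratedFDeriv ℝ 3 f (z + t • y • v) fun _ => v) := by
    rw [hT]
    simp
    ring
  rw [hT', abs_mul]
  have hb : ‖∫ t in (0:ℝ)..1, (1 - t) ^ 2 *
        (y ^ 3 * iteratedFDeriv ℝ 3 f (z + t • y • v) fun _ => v)‖ ≤
      ((K * ‖v‖ ^ 3 * (1 + ‖z‖) ^ N) * (|y| ^ 3 * (1 + B * |y|) ^ N)) * |(1:ℝ) - 0| := by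
    refine intervalIntegral.norm_integral_le_of_norm_le_const fun t ht => ?_
    rw [Set.uIoc_of_le zero_le_one] at ht
    have h1 : ‖iteratedFDeriv ℝ 3 f (z + t • y • v) fun _ => v‖ ≤
        K * (1 + ‖z + t • y • v‖) ^ N * ‖v‖ ^ 3 := by
      refine ((iteratedFDeriv ℝ 3 f (z + t • y • v)).le_opNorm _).trans ?_
      have := hf.2 3 le_rfl (z + t • y • v)
      rw [Real.rpow_natCast] at this
      simp only [Finset.prod_const, Finset.card_univ, Fintype.card_fin]
      gcongr
    have h2 : 1 + ‖z + t • y • v‖ ≤ (1 + ‖z‖) * (1 + B * |y|) := by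
      have : ‖t • y • v‖ ≤ B * |y| := by
        rw [norm_smul, norm_smul, Real.norm_eq_abs, Real.norm_eq_abs, abs_of_pos ht.1]
        have : |y| * ‖v‖ ≤ B * |y| := by rw [mul_comm]; gcongr
        have h0 : 0 ≤ |y| * ‖v‖ := by positivity
        nlinarith [ht.2]
      have h3 := norm_add_le z (t • y • v)
      have : 0 ≤ ‖z‖ * (B * |y|) := by positivity
      nlinarith
    have h4 : (1 - t) ^ 2 ≤ 1 := by nlinarith [ht.1, ht.2]
    rw [norm_mul, norm_mul, norm_pow, norm_pow, Real.norm_eq_abs, Real.norm_eq_abs, sq_abs]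
    calc _ ≤ 1 * (|y| ^ 3 * (K * ((1 + ‖z‖) * (1 + B * |y|)) ^ N * ‖v‖ ^ 3)) := by
          gcongr
          refine h1.trans ?_
          gcongr
      _ = _ := by rw [mul_pow]; ring
  rw [Real.norm_eq_abs] at hb
  have : |(2:ℝ)⁻¹| = 2⁻¹ := abs_of_pos (by norm_num)
  rw [this]
  have h5 := abs_nonneg (∫ t in (0:ℝ)..1, (1 - t) ^ 2 *
        (y ^ 3 * iteratedFDeriv ℝ 3 f (z + t • y • v) fun _ => v))
  norm_num at hb
  linarith

lemma taylor_step {ι : Type*} [Fintype ι] {N : ℕ} {ν : Measure ℝ} (h : Good N ν)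
    {n : ℕ} (hNn : N ≤ n) (hn : n ≤ N + 3) (hev : Even n) (B : ℝ) (hB : 0 ≤ B) :
    ∃ c : ℝ, 0 ≤ c ∧ ∀ (K : ℝ) (f : (ι → ℝ) → ℝ), Gr N K f → ∀ z v : ι → ℝ, ‖v‖ ≤ B →
      |∫ y : ℝ, f (z + y • v) ∂ν - (f z + iteratedFDeriv ℝ 2 f z (fun _ => v) / 2)| ≤
        (K * c) * ‖v‖ ^ 3 * Wt n z := by
  have := h.prob
  refine ⟨(∫ y, |y| ^ 3 * (1 + B * |y|) ^ N ∂ν) * 2 ^ n, by positivity,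
    fun K f hf z v hv => ?_⟩
  have hK := hf.nonneg
  have hfi : Integrable (fun y : ℝ => f (z + y • v)) ν := by
    refine intble1 h hn hev f hf.1.continuous (K * 2 ^ n) (fun z => ?_) z v
    have := hf.2 0 (by norm_num) z
    rw [norm_iteratedFDeriv_zero, Real.rpow_natCast, Real.norm_eq_abs] at this
    refine this.trans ?_
    rw [mul_assoc]
    gcongr
    exact gr_wt hNn hev z
  have hint : Integrable (fun y : ℝ => |y| ^ 3 * (1 + B * |y|) ^ N) ν := by
    have e : (fun y : ℝ => |y| ^ 3 * (1 + B * |y|) ^ N) = fun y =>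
        ∑ l ∈ Finset.range (N + 1), (B ^ (N - l) * N.choose l) * |y| ^ (N - l + 3) := by
      ext y
      rw [add_pow, Finset.mul_sum]
      refine Finset.sum_congr rfl fun l _ => ?_
      rw [mul_pow]; ring
    rw [e]
    exact integrable_finsetSum _ fun l _ => (h.int_abs (by omega)).const_mul _
  have i1 : Integrable (fun y : ℝ => y * iteratedFDeriv ℝ 1 f z (fun _ => v)) ν := by
    have := h.int_pow (l := 1) (by omega)
    simp only [pow_one] at this
    exact this.mul_const _
  have i2 : Integrable (fun y : ℝ => y ^ 2 * (iteratedFDeriv ℝ 2 f z (fun _ => v) / 2)) ν :=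
    (h.int_pow (l := 2) (by omega)).mul_const _
  have i0 : Integrable (fun y : ℝ => f z + y * iteratedFDeriv ℝ 1 f z (fun _ => v)) ν :=
    (integrable_const _).add i1
  have i3 : Integrable (fun y : ℝ => f z + y * iteratedFDeriv ℝ 1 f z (fun _ => v)
      + y ^ 2 * (iteratedFDeriv ℝ 2 f z (fun _ => v) / 2)) ν := i0.add i2
  have e : ∫ y : ℝ, (f z + y * iteratedFDeriv ℝ 1 f z (fun _ => v)
      + y ^ 2 * (iteratedFDeriv ℝ 2 f z (fun _ => v) / 2)) ∂ν =
      f z + iteratedFDeriv ℝ 2 f z (fun _ => v) / 2 := by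
    rw [integral_add i0 i2, integral_add (integrable_const _) i1, integral_mul_const,
      integral_mul_const, h.mean, h.var]
    simp
  rw [← e, ← integral_sub hfi i3]
  refine abs_integral_le_integral_abs.trans ?_
  have : ∫ y : ℝ, |f (z + y • v) - (f z + y * iteratedFDeriv ℝ 1 f z (fun _ => v)
      + y ^ 2 * (iteratedFDeriv ℝ 2 f z (fun _ => v) / 2))| ∂ν ≤
      ∫ y, (K * ‖v‖ ^ 3 * (1 + ‖z‖) ^ N) * (|y| ^ 3 * (1 + B * |y|) ^ N) ∂ν :=
    integral_mono (hfi.sub i3).abs (hint.const_mul _) fun y => taylor_pt hf z v hv y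
  refine this.trans ?_
  rw [integral_const_mul]
  have hW := gr_wt hNn hev z
  have hp : 0 ≤ ∫ y, |y| ^ 3 * (1 + B * |y|) ^ N ∂ν := by positivity
  calc _ ≤ (K * ‖v‖ ^ 3 * (2 ^ n * Wt n z)) * ∫ y, |y| ^ 3 * (1 + B * |y|) ^ N ∂ν := by gcongr
    _ = _ := by ring

/-- Full comparison, with constant uniform over the growth class. -/
lemma compare {ι : Type*} [Fintype ι] {N : ℕ} {ν γ : Measure ℝ} [IsProbabilityMeasure ν]
    [IsProbabilityMeasure γ] (hν : Good N ν) (hγ : Good N γ) (B D T K : ℝ) (hB : 0 ≤ B)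
    (hK : 0 ≤ K) :
    ∃ C : ℝ, 0 ≤ C ∧ ∀ f : (ι → ℝ) → ℝ, Gr N K f → ∀ (d : ℕ) (s : ι → ℝ) (V : Fin d → ι → ℝ),
      (∀ i, ‖V i‖ ≤ B) → ∑ i, ‖V i‖ ^ 2 ≤ D → ‖s‖ ≤ T →
      |∫ y : Fin d → ℝ, f (s + ∑ i, y i • V i) ∂(Measure.pi fun _ : Fin d => ν) -
      ∫ y : Fin d → ℝ, f (s + ∑ i, y i • V i) ∂(Measure.pi fun _ : Fin d => γ)| ≤
      C * ∑ i, ‖V i‖ ^ 3 := by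
  obtain ⟨n, hNn, hn, hev⟩ : ∃ n, N ≤ n ∧ n ≤ N + 3 ∧ Even n := by
    rcases Nat.even_or_odd N with h | h
    · exact ⟨N, le_rfl, by omega, h⟩
    · exact ⟨N + 1, by omega, by omega, h.add_one⟩
  obtain ⟨c1, hc1, h1⟩ := taylor_step (ι := ι) hν hNn hn hev B hB
  obtain ⟨c2, hc2, h2⟩ := taylor_step (ι := ι) hγ hNn hn hev B hB
  obtain ⟨K1, hK1, w1⟩ := weight (ι := ι) hν hn hev B
  obtain ⟨K2, hK2, w2⟩ := weight (ι := ι) hγ hn hev B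
  have hmono : ∀ (L : ℝ) (z v : ι → ℝ), L ≤ K1 + K2 →
      (1 + L * ‖v‖ ^ 2) * Wt n z ≤ (1 + (K1 + K2) * ‖v‖ ^ 2) * Wt n z := by
    intro L z v hL
    have := Wt_one_le hev z
    gcongr
  set Tm := max T 0 with hTm
  refine ⟨(K * c1 + K * c2) * Real.exp ((K1 + K2) * D) * (1 + Fintype.card ι * Tm ^ n),
    by positivity, fun f hf d s V hV hD hs => ?_⟩
  have hL := lindeberg hν hγ hn hev (B := B) (K := K1 + K2) (by positivity)
    (fun z v hv => (w1 z v hv).trans (hmono _ z v (by linarith)))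
    (fun z v hv => (w2 z v hv).trans (hmono _ z v (by linarith)))
    f hf.1.continuous (K * 2 ^ n) (fun z => by
      have := hf.2 0 (by norm_num) z
      rw [norm_iteratedFDeriv_zero, Real.rpow_natCast, Real.norm_eq_abs] at this
      refine this.trans ?_
      rw [mul_assoc]
      gcongr
      exact gr_wt hNn hev z)
    (A := K * c1 + K * c2) (by positivity)
    (fun z v hv => by
      have a1 := h1 K f hf z v hv
      have a2 := h2 K f hf z v hv
      rw [abs_sub_comm] at a2
      refine (abs_sub_le _ (f z + iteratedFDeriv ℝ 2 f z (fun _ => v) / 2) _).trans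
        ((add_le_add a1 a2).trans (le_of_eq (by ring)))) d s V hV
  refine hL.trans ?_
  have hW : Wt n s ≤ 1 + Fintype.card ι * Tm ^ n := by
    unfold Wt
    have : ∑ c, s c ^ n ≤ ∑ _c : ι, Tm ^ n := by
      refine Finset.sum_le_sum fun c _ => ?_
      rw [← hev.pow_abs]
      gcongr
      exact (norm_le_pi_norm s c).trans (hs.trans (le_max_left _ _))
    simpa using this
  have hW1 := Wt_one_le hev s
  calc _ ≤ (K * c1 + K * c2) * (∑ i, ‖V i‖ ^ 3) * Real.exp ((K1 + K2) * D) *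
        (1 + Fintype.card ι * Tm ^ n) := by gcongr
    _ = _ := by ring

lemma MemFq.gr {n : ℕ} {q K : ℝ} (hq : 1 ≤ q) {f : (Fin n → ℝ) → ℝ} (h : MemFq q K f) :
    Gr q (2 * K) f := by
  have hK : 0 ≤ K := by
    have := (norm_nonneg _).trans (h.2 0 (by norm_num) 0)
    rw [norm_zero, Real.zero_rpow (by linarith)] at this
    linarith
  refine ⟨h.1, fun i hi x => (h.2 i hi x).trans ?_⟩
  have h0 := norm_nonneg x
  have h1 : ‖x‖ ^ q ≤ (1 + ‖x‖) ^ q := Real.rpow_le_rpow h0 (by linarith) (by linarith)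
  have h2 : 1 ≤ (1 + ‖x‖) ^ q := Real.one_le_rpow (by linarith) (by linarith)
  nlinarith

lemma good_nu {ν : Measure ℝ} [IsProbabilityMeasure ν] (hmean : ∫ x, x ∂ν = 0)
    (hvar : ∫ x, x ^ 2 ∂ν = 1) {q : ℝ} (hq : 1 ≤ q)
    (h : Integrable (fun x : ℝ => |x| ^ (max (20 * q + 4) (q ^ 2 + 4))) ν) :
    Good ⌈20 * q⌉₊ ν := by
  refine ⟨inferInstance, hmean, hvar, ?_⟩
  set m := max (20 * q + 4) (q ^ 2 + 4) with hm
  have hm0 : 20 * q + 4 ≤ m := le_max_left _ _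
  have hmpos : 0 < m := by linarith
  have h1 : MemLp (fun x : ℝ => x) (ENNReal.ofReal m) ν := by
    rw [← integrable_norm_rpow_iff (by fun_prop) (by simpa using hmpos) ENNReal.ofReal_ne_top]
    simpa [ENNReal.toReal_ofReal hmpos.le] using h
  refine h1.mono_exponent ?_
  rw [← ENNReal.ofReal_natCast]
  apply ENNReal.ofReal_le_ofReal
  have := Nat.ceil_lt_add_one (a := 20 * q) (by linarith)
  push_cast
  linarith

lemma good_gauss (N : ℕ) : Good N (gaussianReal 0 1) := by
  refine ⟨inferInstance, integral_id_gaussianReal, ?_, memLp_id_gaussianReal' _ (by simp)⟩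
  have h1 := variance_id_gaussianReal (μ := 0) (v := 1)
  rw [variance_of_integral_eq_zero (by fun_prop) (by simpa using integral_id_gaussianReal)] at h1
  simpa using h1

lemma pi_norm_pow_le {ι : Type*} [Fintype ι] [Nonempty ι] (z : ι → ℝ) (m : ℕ) :
    ‖z‖ ^ m ≤ ∑ c, |z c| ^ m := by
  obtain ⟨c, hc⟩ : ∃ c, ‖z‖ = |z c| := by
    obtain ⟨c, hc⟩ := Finite.exists_max (fun c => |z c|)
    refine ⟨c, le_antisymm ((pi_norm_le_iff_of_nonempty z).2 hc) (norm_le_pi_norm z c)⟩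
  rw [hc]
  exact Finset.single_le_sum (f := fun c => |z c| ^ m) (fun c _ => by positivity)
    (Finset.mem_univ c)

/-- The features: the projections of `x` on the `θ^c` and on one class mean. -/
def feat {k₁ d : ℕ} (m : Fin d → ℝ) (θ : Fin k₁ → Fin d → ℝ) (x : Fin d → ℝ) :
    Option (Fin k₁) → ℝ := fun o => ∑ i, (o.elim m θ) i * x i

lemma mix_bound {k k₁ N : ℕ} (hk : 0 < k) (hk₁ : 0 < k₁)
    (p : Fin k → ℝ) (hp : ∀ a, 0 ≤ p a) (hpsum : ∑ a, p a = 1)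
    {ν γ : Measure ℝ} [IsProbabilityMeasure ν] [IsProbabilityMeasure γ]
    (hν : Good N ν) (hγ : Good N γ) (R Cμ K : ℝ) (hK : 0 ≤ K) (hCμ : 0 < Cμ) :
    ∃ C : ℝ, 0 < C ∧
      ∀ (d : ℕ) (μ : Fin k → Fin d → ℝ), (∀ j, Real.sqrt (n2sq (μ j)) ≤ Cμ) →
        ∀ (θ : Fin k₁ → Fin d → ℝ), (∑ c, n2sq (θ c)) ≤ R ^ 2 → ∀ b : Fin k,
        ∀ f : Fin k → (Option (Fin k₁) → ℝ) → ℝ, (∀ j, Gr N K (f j)) →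
        ∀ F : Fin k → (Fin d → ℝ) → ℝ, (∀ j x, F j x = f j (feat (μ b) θ x)) →
          |mixE p μ ν F - mixE p μ γ F|
            ≤ C * max
                (Finset.univ.sup' (Finset.univ_nonempty_iff.mpr ⟨⟨0, hk₁⟩⟩)
                  fun c => n3cube (θ c))
                (Finset.univ.sup' (Finset.univ_nonempty_iff.mpr ⟨⟨0, hk⟩⟩)
                  fun c => n3cube (μ c)) := by
  set D : ℝ := Cμ ^ 2 + R ^ 2 with hD
  have hD0 : 0 ≤ D := by positivity
  obtain ⟨C, hC, H⟩ := compare (ι := Option (Fin k₁)) hν hγ (Real.sqrt D) D (2 * D) K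
    (Real.sqrt_nonneg _) hK
  refine ⟨C * (k₁ + 1) + 1, by positivity, ?_⟩
  intro d μ hμ θ hθ b f hf F hF
  set M := max
                (Finset.univ.sup' (Finset.univ_nonempty_iff.mpr ⟨⟨0, hk₁⟩⟩)
                  fun c => n3cube (θ c))
                (Finset.univ.sup' (Finset.univ_nonempty_iff.mpr ⟨⟨0, hk⟩⟩)
                  fun c => n3cube (μ c)) with hM
  have hMθ : ∀ c, n3cube (θ c) ≤ M := fun c =>
    le_max_of_le_left (Finset.le_sup' (fun c => n3cube (θ c)) (Finset.mem_univ c))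
  have hMμ : ∀ c, n3cube (μ c) ≤ M := fun c =>
    le_max_of_le_right (Finset.le_sup' (fun c => n3cube (μ c)) (Finset.mem_univ c))
  have hM0 : 0 ≤ M := le_trans (by unfold n3cube; positivity) (hMμ b)
  have hn2 : ∀ v : Fin d → ℝ, 0 ≤ n2sq v := fun v => by unfold n2sq; positivity
  have hμ2 : ∀ j, n2sq (μ j) ≤ Cμ ^ 2 := fun j => (Real.sqrt_le_left hCμ.le).1 (hμ j)
  set U : Option (Fin k₁) → Fin d → ℝ := fun o => o.elim (μ b) θ with hU
  set V : Fin d → Option (Fin k₁) → ℝ := fun i o => U o i with hV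
  have hsum2 : ∑ o, n2sq (U o) ≤ D := by
    rw [Fintype.sum_option]
    exact add_le_add (hμ2 b) hθ
  have hsum3 : ∑ o, n3cube (U o) ≤ (k₁ + 1) * M := by
    rw [Fintype.sum_option]
    have h1 : ∑ c, n3cube (θ c) ≤ k₁ * M := by
      refine (Finset.sum_le_sum fun c _ => hMθ c).trans (by simp)
    have h2 : n3cube (U none) ≤ M := hMμ b
    have h3 : ∑ c, n3cube (U (some c)) = ∑ c, n3cube (θ c) := rfl
    rw [h3]
    linarith
  have hV2 : ∑ i, ‖V i‖ ^ 2 ≤ D := by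
    refine le_trans (Finset.sum_le_sum fun i _ => pi_norm_pow_le (V i) 2) ?_
    rw [Finset.sum_comm]
    simpa [hV, n2sq] using hsum2
  have hV3 : ∑ i, ‖V i‖ ^ 3 ≤ (k₁ + 1) * M := by
    refine le_trans (Finset.sum_le_sum fun i _ => pi_norm_pow_le (V i) 3) ?_
    rw [Finset.sum_comm]
    simpa [hV, n3cube] using hsum3
  have hVB : ∀ i, ‖V i‖ ≤ Real.sqrt D := fun i => by
    refine Real.le_sqrt_of_sq_le (le_trans ?_ hV2)
    exact Finset.single_le_sum (f := fun i => ‖V i‖ ^ 2) (fun i _ => by positivity)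
      (Finset.mem_univ i)
  have hs : ∀ j, ‖feat (μ b) θ (μ j)‖ ≤ 2 * D := by
    intro j
    rw [pi_norm_le_iff_of_nonneg (by positivity)]
    intro o
    have h1 : |∑ i, U o i * μ j i| ≤ ∑ i, ((U o i) ^ 2 + (μ j i) ^ 2) := by
      refine (Finset.abs_sum_le_sum_abs _ _).trans (Finset.sum_le_sum fun i _ => ?_)
      rw [abs_le]
      constructor <;> nlinarith [sq_nonneg (U o i + μ j i), sq_nonneg (U o i - μ j i)]
    rw [Finset.sum_add_distrib] at h1
    have h2 : n2sq (U o) ≤ D := le_trans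
      (Finset.single_le_sum (f := fun o => n2sq (U o)) (fun o _ => hn2 _) (Finset.mem_univ o)) hsum2
    have h3 : n2sq (μ j) ≤ D := (hμ2 j).trans (by nlinarith [sq_nonneg R])
    unfold n2sq at h2 h3
    exact h1.trans (by linarith)
  have hkey : ∀ j (y : Fin d → ℝ), F j (fun i => μ j i + y i)
      = f j (feat (μ b) θ (μ j) + ∑ i, y i • V i) := by
    intro j y
    rw [hF]
    congr 1
    funext o
    simp only [feat, Pi.add_apply, Finset.sum_apply, Pi.smul_apply, smul_eq_mul, hV, hU]
    rw [← Finset.sum_add_distrib]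
    exact Finset.sum_congr rfl fun i _ => by ring
  unfold mixE
  rw [← Finset.sum_sub_distrib]
  simp_rw [hkey, ← mul_sub]
  refine (Finset.abs_sum_le_sum_abs _ _).trans ?_
  have hterm : ∀ j, |p j * (∫ y : Fin d → ℝ, f j (feat (μ b) θ (μ j) + ∑ i, y i • V i)
        ∂(Measure.pi fun _ : Fin d => ν) - ∫ y : Fin d → ℝ,
        f j (feat (μ b) θ (μ j) + ∑ i, y i • V i) ∂(Measure.pi fun _ : Fin d => γ))|
        ≤ p j * (C * ((k₁ + 1) * M)) := by
    intro j
    rw [abs_mul, abs_of_nonneg (hp j)]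
    refine mul_le_mul_of_nonneg_left ?_ (hp j)
    exact (H (f j) (hf j) d _ V hVB hV2 (hs j)).trans (mul_le_mul_of_nonneg_left hV3 hC)
  refine (Finset.sum_le_sum fun j _ => hterm j).trans ?_
  rw [← Finset.sum_mul, hpsum]
  linarith

/-- Forget the extra coordinate. -/
noncomputable def restr (k₁ : ℕ) : (Option (Fin k₁) → ℝ) →L[ℝ] (Fin k₁ → ℝ) :=
  ContinuousLinearMap.pi fun c => ContinuousLinearMap.proj (some c)

lemma restr_norm (k₁ : ℕ) : ‖restr k₁‖ ≤ 1 := by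
  refine ContinuousLinearMap.opNorm_le_bound _ zero_le_one fun z => ?_
  rw [one_mul, pi_norm_le_iff_of_nonneg (norm_nonneg z)]
  exact fun c => norm_le_pi_norm z (some c)

lemma proj_gr {k₁ : ℕ} (o : Option (Fin k₁)) :
    Gr 1 1 (fun z : Option (Fin k₁) → ℝ => z o) := by
  refine (Gr.lin (ContinuousLinearMap.proj (R := ℝ) (φ := fun _ : Option (Fin k₁) => ℝ) o)).mono
    le_rfl ?_
  refine ContinuousLinearMap.opNorm_le_bound _ zero_le_one fun z => ?_
  rw [one_mul]
  exact norm_le_pi_norm z o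

lemma restr_feat {k₁ d : ℕ} (m : Fin d → ℝ) (θ : Fin k₁ → Fin d → ℝ) (x : Fin d → ℝ) :
    restr k₁ (feat m θ x) = projv θ x := rfl

/-- Universality of expectations of the family `G₀` of functions of the
data for projective models: under Assumption A, with coordinate-delocalized class means
of bounded norm, for each member `F` of `G₀` there is a constant `C` (uniform in the
dimension `d` and in `Θ` in the ball of radius `R`) such that the `ν`-mixture expectation
and the Gaussian-mixture expectation of `F` differ by at most
`C·(max_a ‖θ^a‖₃³ ∨ ‖μ^a‖₃³)`. -/
theorem universality_G0_family
    (k k₁ k₂ Cl : ℕ) (hk : 0 < k) (hk₁ : 0 < k₁) (hk₂ : 0 < k₂) (hCl : 0 < Cl)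
    (ψ : (Fin k₁ → ℝ) → (Fin k₂ → ℝ) → Fin Cl → ℝ) (ylab : Fin k → Fin Cl)
    (p : Fin k → ℝ) (hp : ∀ a, 0 ≤ p a) (hpsum : ∑ a, p a = 1)
    (ν : Measure ℝ) [IsProbabilityMeasure ν]
    (hmean : ∫ x, x ∂ν = 0) (hvar : ∫ x, x ^ 2 ∂ν = 1)
    (q : ℝ) (hA : AssumptionA q ψ ν)
    (ζ : ℝ) (hζ : ζ ≤ 1 / 8) (R : ℝ) (hR : 0 < R) (Cμ : ℝ) (hCμ : 0 < Cμ)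
    (a a' : Fin k₁) (b : Fin k) (b₂ : Fin k₂) (pp : ℕ) (hpp₁ : 1 ≤ pp) (hpp₂ : pp ≤ 20) :
    ∃ C : ℝ, 0 < C ∧
      ∀ (d : ℕ) (μ : Fin k → Fin d → ℝ),
        (∀ j, Deloc ζ (μ j)) → (∀ j, Real.sqrt (n2sq (μ j)) ≤ Cμ) →
        ∀ (θ : Fin k₁ → Fin d → ℝ) (w : Fin k₂ → ℝ),
          (∑ c, n2sq (θ c)) + ∑ c, (w c) ^ 2 ≤ R ^ 2 →
          (|mixE p μ ν (fun j x => d1 ψ a (projv θ x) w (ylab j) * ∑ i, x i * μ b i)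
              - mixE p μ (gaussianReal 0 1)
                  (fun j x => d1 ψ a (projv θ x) w (ylab j) * ∑ i, x i * μ b i)|
            ≤ C * max
                (Finset.univ.sup' (Finset.univ_nonempty_iff.mpr ⟨⟨0, hk₁⟩⟩)
                  fun c => n3cube (θ c))
                (Finset.univ.sup' (Finset.univ_nonempty_iff.mpr ⟨⟨0, hk⟩⟩)
                  fun c => n3cube (μ c))) ∧
          (|mixE p μ ν (fun j x => d1 ψ a (projv θ x) w (ylab j) * ∑ i, x i * θ a' i)
              - mixE p μ (gaussianReal 0 1)
                  (fun j x => d1 ψ a (projv θ x) w (ylab j) * ∑ i, x i * θ a' i)|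
            ≤ C * max
                (Finset.univ.sup' (Finset.univ_nonempty_iff.mpr ⟨⟨0, hk₁⟩⟩)
                  fun c => n3cube (θ c))
                (Finset.univ.sup' (Finset.univ_nonempty_iff.mpr ⟨⟨0, hk⟩⟩)
                  fun c => n3cube (μ c))) ∧
          (|mixE p μ ν (fun j x => d2 ψ b₂ (projv θ x) w (ylab j))
              - mixE p μ (gaussianReal 0 1)
                  (fun j x => d2 ψ b₂ (projv θ x) w (ylab j))|
            ≤ C * max
                (Finset.univ.sup' (Finset.univ_nonempty_iff.mpr ⟨⟨0, hk₁⟩⟩)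
                  fun c => n3cube (θ c))
                (Finset.univ.sup' (Finset.univ_nonempty_iff.mpr ⟨⟨0, hk⟩⟩)
                  fun c => n3cube (μ c))) ∧
          (|mixE p μ ν
                (fun j x => d1 ψ a (projv θ x) w (ylab j) * d1 ψ a' (projv θ x) w (ylab j))
              - mixE p μ (gaussianReal 0 1)
                  (fun j x => d1 ψ a (projv θ x) w (ylab j) * d1 ψ a' (projv θ x) w (ylab j))|
            ≤ C * max
                (Finset.univ.sup' (Finset.univ_nonempty_iff.mpr ⟨⟨0, hk₁⟩⟩)
                  fun c => n3cube (θ c))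
                (Finset.univ.sup' (Finset.univ_nonempty_iff.mpr ⟨⟨0, hk⟩⟩)
                  fun c => n3cube (μ c))) ∧
          (|mixE p μ ν (fun j x => (d1 ψ a (projv θ x) w (ylab j)) ^ pp)
              - mixE p μ (gaussianReal 0 1)
                  (fun j x => (d1 ψ a (projv θ x) w (ylab j)) ^ pp)|
            ≤ C * max
                (Finset.univ.sup' (Finset.univ_nonempty_iff.mpr ⟨⟨0, hk₁⟩⟩)
                  fun c => n3cube (θ c))
                (Finset.univ.sup' (Finset.univ_nonempty_iff.mpr ⟨⟨0, hk⟩⟩)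
                  fun c => n3cube (μ c))) ∧
          (|mixE p μ ν (fun j x => (d2 ψ b₂ (projv θ x) w (ylab j)) ^ pp)
              - mixE p μ (gaussianReal 0 1)
                  (fun j x => (d2 ψ b₂ (projv θ x) w (ylab j)) ^ pp)|
            ≤ C * max
                (Finset.univ.sup' (Finset.univ_nonempty_iff.mpr ⟨⟨0, hk₁⟩⟩)
                  fun c => n3cube (θ c))
                (Finset.univ.sup' (Finset.univ_nonempty_iff.mpr ⟨⟨0, hk⟩⟩)
                  fun c => n3cube (μ c))) := by
  obtain ⟨hq, hint, hAR⟩ := hA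
  obtain ⟨K, hK⟩ := hAR R hR
  set N := ⌈20 * q⌉₊ with hN
  have hNq : 20 * q ≤ N := Nat.le_ceil _
  have hK0 : 0 ≤ 2 * K :=
    (((hK 0 (by simpa using hR.le) ⟨0, hCl⟩).1 a).gr hq).nonneg
  set K1 : ℝ := 2 * K with hK1
  set K2 : ℝ := 8 * (K1 * 1) + K1 + 8 * (K1 * K1) + (8 * K1) ^ pp with hK2
  have hK20 : 0 ≤ K2 := by positivity
  obtain ⟨C, hC, H⟩ := mix_bound hk hk₁ p hp hpsum (good_nu hmean hvar hq hint)
    (good_gauss N) R Cμ K2 hK20 hCμ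
  refine ⟨C, hC, ?_⟩
  intro d μ _ hμ θ w hΘ
  have hw2 : 0 ≤ ∑ c, (w c) ^ 2 := by positivity
  have hθ2 : 0 ≤ ∑ c, n2sq (θ c) := Finset.sum_nonneg fun c _ => by unfold n2sq; positivity
  have hw : ‖w‖ ≤ R := by
    rw [pi_norm_le_iff_of_nonneg hR.le]
    intro c
    have := Finset.single_le_sum (f := fun c => (w c) ^ 2) (fun c _ => sq_nonneg _)
      (Finset.mem_univ c)
    exact abs_le_of_sq_le_sq (by linarith) hR.le
  have G1 : ∀ a j, Gr q K1 (fun z => d1 ψ a (restr k₁ z) w (ylab j)) := fun a j =>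
    (((hK w hw (ylab j)).1 a).gr hq).comp (by linarith) (restr k₁) (restr_norm k₁)
  have G2 : ∀ j, Gr q K1 (fun z => d2 ψ b₂ (restr k₁ z) w (ylab j)) := fun j =>
    (((hK w hw (ylab j)).2 b₂).gr hq).comp (by linarith) (restr k₁) (restr_norm k₁)
  have e1 : 0 ≤ 8 * (K1 * 1) := by positivity
  have e2 : 0 ≤ 8 * (K1 * K1) := by positivity
  have e3 : 0 ≤ (8 * K1) ^ pp := by positivity
  have hppq : (pp : ℝ) * q ≤ N := by
    have : (pp : ℝ) ≤ 20 := by exact_mod_cast hpp₂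
    nlinarith
  have H' := H d μ hμ θ (by linarith) b
  refine ⟨?_, ?_, ?_, ?_, ?_, ?_⟩
  · refine H' (fun j z => d1 ψ a (restr k₁ z) w (ylab j) * z none)
      (fun j => ((G1 a j).mul (proj_gr none)).mono (by linarith) (by linarith)) _ fun j x => ?_
    simp only [restr_feat]
    simp only [feat, Option.elim, mul_comm]
  · refine H' (fun j z => d1 ψ a (restr k₁ z) w (ylab j) * z (some a'))
      (fun j => ((G1 a j).mul (proj_gr (some a'))).mono (by linarith) (by linarith)) _
      fun j x => ?_
    simp only [restr_feat]
    simp only [feat, Option.elim, mul_comm]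
  · exact H' (fun j z => d2 ψ b₂ (restr k₁ z) w (ylab j))
      (fun j => (G2 j).mono (by linarith) (by linarith)) _ fun j x => rfl
  · exact H' (fun j z => d1 ψ a (restr k₁ z) w (ylab j) * d1 ψ a' (restr k₁ z) w (ylab j))
      (fun j => ((G1 a j).mul (G1 a' j)).mono (by linarith) (by linarith)) _ fun j x => rfl
  · exact H' (fun j z => (d1 ψ a (restr k₁ z) w (ylab j)) ^ pp)
      (fun j => ((G1 a j).pow pp).mono hppq (by linarith)) _ fun j x => rfl
  · exact H' (fun j z => (d2 ψ b₂ (restr k₁ z) w (ylab j)) ^ pp)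
      (fun j => ((G2 j).pow pp).mono hppq (by linarith)) _ fun j x => rfl
end

section
/- (Non-universality with coordinate-aligned initialization.) Consider online SGD at learning rate δ = c_LR/d for the smooth phase retrieval loss L(θ, X) = |⟨X,θ⟩² − ⟨X,θ*⟩²|² with θ* = d^{−1/2}·𝟙, and features X with i.i.d. coordinates Xᵢ ~ ν, where ν is centered with variance one, all finite moments, and E_ν[X₁⁴] ≠ 3. For all except at most one value of c_LR > 0, the following holds: if the initialization is θ₀ = e₁ (the first standard basis vector), then the trajectories of the summary statistics G_{⌊tδ^{−1}⌋} = (θ_{⌊tδ^{−1}⌋}, θ*)ᵀ(θ_{⌊tδ^{−1}⌋}, θ*) do not converge, as d → ∞, to the ODE limit that they follow when the feature distribution is instead i.i.d. N(0,1) (and with the same initialization). -/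
open MeasureTheory ProbabilityTheory Filter Finset

/-- Linear interpolation of the discrete path `v : ℕ → E` on timescale `δ`. -/
noncomputable def interp {E : Type*} [AddCommGroup E] [Module ℝ E]
    (δ : ℝ) (v : ℕ → E) (t : ℝ) : E :=
  (1 - (max (t / δ) 0 - ⌊max (t / δ) 0⌋₊)) • v ⌊max (t / δ) 0⌋₊
    + (max (t / δ) 0 - ⌊max (t / δ) 0⌋₊) • v (⌊max (t / δ) 0⌋₊ + 1)

/-- The law of an i.i.d. stream of feature vectors, realized on `ℕ`-indexed sequences by
extending a finite product over the first `N` coordinates. -/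
noncomputable def featStream {d : ℕ} (N : ℕ) (P : Measure (Fin d → ℝ)) :
    Measure (ℕ → Fin d → ℝ) :=
  (Measure.pi fun _ : Fin N => P).map
    (fun ω n => if h : n < N then ω ⟨n, h⟩ else fun _ => 0)

/-- One step of online SGD for the smooth phase retrieval loss
`L(θ, X) = |⟨X,θ⟩² − ⟨X,θ*⟩²|²`. -/
noncomputable def sgdPRStep {d : ℕ} (δ : ℝ) (tstar θ x : Fin d → ℝ) : Fin d → ℝ :=
  fun i => θ i - δ * (4 * ((∑ j, x j * θ j) ^ 2 - (∑ j, x j * tstar j) ^ 2)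
    * (∑ j, x j * θ j) * x i)

/-- Online SGD for smooth phase retrieval, driven by the feature stream `ω`. -/
noncomputable def sgdPR {d : ℕ} (δ : ℝ) (tstar θ₀ : Fin d → ℝ)
    (ω : ℕ → Fin d → ℝ) : ℕ → Fin d → ℝ
  | 0 => θ₀
  | ℓ + 1 => sgdPRStep δ tstar (sgdPR δ tstar θ₀ ω ℓ) (ω ℓ)

/-- The `2 × 2` Gram matrix of `(θ, θ*)`. -/
noncomputable def gram2 {d : ℕ} (θ tstar : Fin d → ℝ) : Fin 2 → Fin 2 → ℝ :=
  fun a b => ∑ i, ![θ, tstar] a i * ![θ, tstar] b i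

/-- Convergence, locally uniformly in probability as `d → ∞`, of the interpolated
summary statistics of phase-retrieval SGD (step size `c_LR/d`, ground truth
`θ* = d^{-1/2}𝟙`, initialization `θ₀ = e₁`, i.i.d. features with coordinate law `η`) to
the deterministic trajectory `u`. -/
def prConv (η : Measure ℝ) (cLR : ℝ) (u : ℝ → Fin 2 → Fin 2 → ℝ) : Prop :=
  ∀ T : ℝ, 0 < T → ∀ ε : ℝ, 0 < ε →
    Tendsto (fun d : ℕ =>
        featStream (⌈(T + 1) * (cLR / d)⁻¹⌉₊ + 2) (Measure.pi fun _ : Fin d => η)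
          {ω | ∃ t ∈ Set.Icc (0 : ℝ) T,
            ε ≤ ‖interp (cLR / d)
                  (fun ℓ => gram2
                    (sgdPR (cLR / d) (fun _ => (Real.sqrt d)⁻¹)
                      (fun i => if (i : ℕ) = 0 then 1 else 0) ω ℓ)
                    (fun _ => (Real.sqrt d)⁻¹)) t
                - u t‖})
      atTop (nhds 0)

section helpers

/-- Families of functions with uniformly bounded moments. -/
structure UB {ι : Type} {Ω : ι → Type} [∀ i, MeasurableSpace (Ω i)]
    (μ : ∀ i, Measure (Ω i)) (F : ∀ i, Ω i → ℝ) : Prop where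
  meas : ∀ i, Measurable (F i)
  bdd : ∀ k : ℕ, ∃ K : ℝ, ∀ i, Integrable (fun x => F i x ^ (2 * k)) (μ i) ∧
    ∫ x, F i x ^ (2 * k) ∂(μ i) ≤ K

variable {ι : Type} {Ω : ι → Type} [∀ i, MeasurableSpace (Ω i)]
    {μ : ∀ i, Measure (Ω i)}

lemma UB.of_dom {F : ∀ i, Ω i → ℝ} (hm : ∀ i, Measurable (F i))
    (h : ∀ k : ℕ, ∃ (H : ∀ i, Ω i → ℝ) (K : ℝ), (∀ i, Integrable (H i) (μ i)) ∧
      (∀ i x, F i x ^ (2 * k) ≤ H i x) ∧ ∀ i, ∫ x, H i x ∂(μ i) ≤ K) : UB μ F := by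
  refine ⟨hm, fun k => ?_⟩
  obtain ⟨H, K, h1, h2, h3⟩ := h k
  refine ⟨K, fun i => ?_⟩
  have hI : Integrable (fun x => F i x ^ (2 * k)) (μ i) := by
    refine (h1 i).mono ((hm i).pow_const _).aestronglyMeasurable (Eventually.of_forall fun x => ?_)
    have h0 : 0 ≤ F i x ^ (2 * k) := by rw [pow_mul]; positivity
    rw [Real.norm_of_nonneg h0]
    exact (h2 i x).trans (le_abs_self _)
  exact ⟨hI, (integral_mono hI (h1 i) (h2 i)).trans (h3 i)⟩

variable [∀ i, IsProbabilityMeasure (μ i)]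

lemma UB.const (c : ι → ℝ) (C : ℝ) (hC : ∀ i, |c i| ≤ C) : UB μ (fun i _ => c i) := by
  refine ⟨fun i => measurable_const, fun k => ⟨C ^ (2 * k), fun i => ?_⟩⟩
  refine ⟨integrable_const _, ?_⟩
  simp only [integral_const, probReal_univ, one_smul]
  calc c i ^ (2 * k) ≤ |c i ^ (2 * k)| := le_abs_self _
    _ = |c i| ^ (2 * k) := abs_pow _ _
    _ ≤ C ^ (2 * k) := by gcongr; exact hC i

lemma UB.cst (c : ℝ) : UB μ (fun _ _ => c) := UB.const _ |c| (fun _ => le_rfl)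

lemma UB.mul {F G : ∀ i, Ω i → ℝ} (hF : UB μ F) (hG : UB μ G) :
    UB μ (fun i x => F i x * G i x) := by
  refine UB.of_dom (fun i => (hF.meas i).mul (hG.meas i)) fun k => ?_
  obtain ⟨K1, h1⟩ := hF.bdd (2 * k)
  obtain ⟨K2, h2⟩ := hG.bdd (2 * k)
  refine ⟨fun i x => F i x ^ (2 * (2 * k)) + G i x ^ (2 * (2 * k)), K1 + K2,
    fun i => (h1 i).1.add (h2 i).1, fun i x => ?_, fun i => ?_⟩
  · have e1 : ∀ y : ℝ, y ^ (2 * (2 * k)) = (y ^ (2 * k)) ^ 2 := fun y => by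
      rw [← pow_mul]; congr 1; ring
    beta_reduce
    rw [e1, e1, mul_pow]
    nlinarith [sq_nonneg (F i x ^ (2 * k) - G i x ^ (2 * k)), sq_nonneg (F i x ^ (2 * k)),
      sq_nonneg (G i x ^ (2 * k))]
  · rw [integral_add (h1 i).1 (h2 i).1]
    exact add_le_add (h1 i).2 (h2 i).2

lemma UB.add {F G : ∀ i, Ω i → ℝ} (hF : UB μ F) (hG : UB μ G) :
    UB μ (fun i x => F i x + G i x) := by
  refine UB.of_dom (fun i => (hF.meas i).add (hG.meas i)) fun k => ?_
  obtain ⟨K1, h1⟩ := hF.bdd k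
  obtain ⟨K2, h2⟩ := hG.bdd k
  refine ⟨fun i x => 2 ^ (2 * k) * (F i x ^ (2 * k) + G i x ^ (2 * k)), 2 ^ (2 * k) * (K1 + K2),
    fun i => ((h1 i).1.add (h2 i).1).const_mul _, fun i x => ?_, fun i => ?_⟩
  · have hh : ∀ a b : ℝ, 0 ≤ a → 0 ≤ b → (a + b) ^ k ≤ 2 ^ k * (a ^ k + b ^ k) := by
      intro a b ha hb
      rcases le_total a b with h | h
      · calc (a + b) ^ k ≤ (2 * b) ^ k := by gcongr; linarith
          _ = 2 ^ k * b ^ k := mul_pow _ _ _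
          _ ≤ _ := by gcongr; linarith [pow_nonneg ha k]
      · calc (a + b) ^ k ≤ (2 * a) ^ k := by gcongr; linarith
          _ = 2 ^ k * a ^ k := mul_pow _ _ _
          _ ≤ _ := by gcongr; linarith [pow_nonneg hb k]
    have h3 := hh (F i x ^ 2) (G i x ^ 2) (by positivity) (by positivity)
    beta_reduce
    rw [pow_mul, pow_mul, pow_mul, pow_mul]
    calc ((F i x + G i x) ^ 2) ^ k ≤ (2 * (F i x ^ 2 + G i x ^ 2)) ^ k := by
          gcongr; nlinarith [sq_nonneg (F i x - G i x)]
      _ = 2 ^ k * (F i x ^ 2 + G i x ^ 2) ^ k := mul_pow _ _ _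
      _ ≤ 2 ^ k * (2 ^ k * ((F i x ^ 2) ^ k + (G i x ^ 2) ^ k)) := by gcongr
      _ = _ := by rw [← mul_assoc, ← mul_pow]; norm_num
  · rw [integral_const_mul, integral_add (h1 i).1 (h2 i).1]
    gcongr
    · exact (h1 i).2
    · exact (h2 i).2

lemma UB.neg {F : ∀ i, Ω i → ℝ} (hF : UB μ F) : UB μ (fun i x => - F i x) := by
  simpa using (UB.cst (μ := μ) (-1)).mul hF

lemma UB.sub {F G : ∀ i, Ω i → ℝ} (hF : UB μ F) (hG : UB μ G) :
    UB μ (fun i x => F i x - G i x) := by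
  simpa [sub_eq_add_neg] using hF.add hG.neg

lemma UB.pow {F : ∀ i, Ω i → ℝ} (hF : UB μ F) (m : ℕ) : UB μ (fun i x => F i x ^ m) := by
  induction m with
  | zero => simpa using UB.cst (μ := μ) 1
  | succ m ih => simpa [pow_succ] using ih.mul hF

lemma UB.integrable {F : ∀ i, Ω i → ℝ} (hF : UB μ F) (i : ι) : Integrable (F i) (μ i) := by
  obtain ⟨K, h⟩ := hF.bdd 1
  simp only [mul_one] at h
  refine Integrable.mono ((h i).1.add (integrable_const 1)) (hF.meas i).aestronglyMeasurable
    (Eventually.of_forall fun x => ?_)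
  simp only [Pi.add_apply, Real.norm_eq_abs]
  rw [abs_of_nonneg (a := F i x ^ 2 + 1) (by positivity)]
  have := sq_abs (F i x)
  nlinarith [sq_nonneg (|F i x| - 1)]

lemma UB.bound {F : ∀ i, Ω i → ℝ} (hF : UB μ F) : ∃ K : ℝ, 0 ≤ K ∧ ∀ i, ∫ x, F i x ∂(μ i) ≤ K := by
  obtain ⟨K, h⟩ := hF.bdd 1
  simp only [mul_one] at h
  refine ⟨|K| + 1, by positivity, fun i => ?_⟩
  have h1 : ∫ x, F i x ∂(μ i) ≤ ∫ x, (F i x ^ 2 + 1) ∂(μ i) := by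
    refine integral_mono (hF.integrable i) ((h i).1.add (integrable_const 1)) fun x => ?_
    simp only
    nlinarith [sq_nonneg (F i x - 1)]
  rw [integral_add (h i).1 (integrable_const 1)] at h1
  simp only [integral_const, probReal_univ, one_smul] at h1
  linarith [(h i).2, le_abs_self K]

/-- Cauchy-Schwarz. -/
lemma cs_int {α : Type} [MeasurableSpace α] {m : Measure α} {f g : α → ℝ}
    (hf : Integrable (fun x => f x ^ 2) m) (hg : Integrable (fun x => g x ^ 2) m)
    (hfg : Integrable (fun x => f x * g x) m) :
    (∫ x, f x * g x ∂m) ^ 2 ≤ (∫ x, f x ^ 2 ∂m) * ∫ x, g x ^ 2 ∂m := by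
  have key : ∀ l : ℝ, 0 ≤ (∫ x, g x ^ 2 ∂m) * (l * l) + (2 * ∫ x, f x * g x ∂m) * l
      + ∫ x, f x ^ 2 ∂m := by
    intro l
    have h1 : 0 ≤ ∫ x, (f x + l * g x) ^ 2 ∂m := integral_nonneg fun x => sq_nonneg _
    have h2 : ∫ x, (f x + l * g x) ^ 2 ∂m
        = ∫ x, (f x ^ 2 + (2 * l) * (f x * g x) + (l * l) * g x ^ 2) ∂m := by
      congr 1; ext x; ring
    rw [h2, integral_add (by exact hf.add (hfg.const_mul _)) (hg.const_mul _),
      integral_add hf (hfg.const_mul _), integral_const_mul, integral_const_mul] at h1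
    linarith
  have := discrim_le_zero key
  rw [discrim] at this
  nlinarith

end helpers

lemma gauss_int (n : ℕ) : Integrable (fun x : ℝ => |x| ^ n) (gaussianReal 0 1) := by
  have := (memLp_id_gaussianReal (μ := 0) (v := 1) (n : NNReal)).integrable_norm_pow'
  simpa using this

lemma gauss_mom (n : ℕ) : iteratedDeriv n (fun t : ℝ => Real.exp (t ^ 2 / 2)) 0 
    = ∫ x, x ^ n ∂(gaussianReal 0 1) := by
  have h := iteratedDeriv_mgf_zero (X := id) (μ := gaussianReal 0 1) (by simp) n
  rw [mgf_id_gaussianReal] at h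
  simpa using h

lemma gd (p q : ℝ → ℝ) (h : ∀ t, HasDerivAt p (q t - t * p t) t) :
    deriv (fun t : ℝ => p t * Real.exp (t ^ 2 / 2)) = fun t => q t * Real.exp (t ^ 2 / 2) := by
  ext t
  have h1 : HasDerivAt (fun t : ℝ => t ^ 2 / 2) t t := by
    exact ((hasDerivAt_pow 2 t).div_const 2).congr_deriv (by norm_num)
  have := (h t).mul h1.exp
  rw [show (fun t : ℝ => p t * Real.exp (t ^ 2 / 2)) = p * (fun t : ℝ => Real.exp (t ^ 2 / 2)) from rfl]
  rw [this.deriv]; ring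

lemma gauss46 : (∫ x, x ^ 4 ∂(gaussianReal 0 1) = 3) ∧ (∫ x, x ^ 6 ∂(gaussianReal 0 1) = 15)
    ∧ (∫ x, x ^ 2 ∂(gaussianReal 0 1) = 1) := by
  have e0 : (fun t : ℝ => Real.exp (t ^ 2 / 2)) = fun t => (fun _ => (1:ℝ)) t * Real.exp (t ^ 2 / 2) := by
    ext; simp
  have d1 := gd (fun _ => 1) (fun t => t) (fun t => by
    exact (hasDerivAt_const t (1:ℝ)).congr_deriv (by ring))
  have d2 := gd (fun t => t) (fun t => 1 + t^2) (fun t => by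
    exact (hasDerivAt_id t).congr_deriv (by ring))
  have d3 := gd (fun t => 1 + t^2) (fun t => 3 * t + t^3) (fun t => by
    exact ((hasDerivAt_pow 2 t).const_add 1).congr_deriv (by norm_num; ring))
  have d4 := gd (fun t => 3 * t + t^3) (fun t => 3 + 6 * t ^ 2 + t^4) (fun t => by
    exact (((hasDerivAt_id t).const_mul 3).add (hasDerivAt_pow 3 t)).congr_deriv (by norm_num; ring))
  have d5 := gd (fun t => 3 + 6 * t ^ 2 + t^4) (fun t => 15 * t + 10 * t ^ 3 + t^5) (fun t => by
    exact ((((hasDerivAt_pow 2 t).const_mul 6).const_add 3).add (hasDerivAt_pow 4 t)).congr_deriv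
      (by norm_num; ring))
  have d6 := gd (fun t => 15 * t + 10 * t ^ 3 + t^5) 
    (fun t => 15 + 45 * t ^ 2 + 15 * t ^ 4 + t ^ 6) (fun t => by
    exact ((((hasDerivAt_id t).const_mul 15).add ((hasDerivAt_pow 3 t).const_mul 10)).add
      (hasDerivAt_pow 5 t)).congr_deriv (by norm_num; ring))
  refine ⟨?_, ?_, ?_⟩ <;> rw [← gauss_mom, e0] <;>
    simp only [iteratedDeriv_succ, iteratedDeriv_zero, d1, d2, d3, d4, d5, d6] <;> norm_num
section moments

lemma mp_cons {E : Type} [MeasurableSpace E] (P : Measure E) [IsProbabilityMeasure P] (n : ℕ) :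
    MeasurePreserving (fun p : E × (Fin n → E) => (Fin.cons p.1 p.2 : Fin (n + 1) → E))
      (P.prod (Measure.pi fun _ => P)) (Measure.pi fun _ => P) := by
  have h := (measurePreserving_piFinSuccAbove (fun _ : Fin (n + 1) => P) 0).symm
  convert h using 1
  funext q
  simp [MeasurableEquiv.piFinSuccAbove, Fin.insertNthEquiv, Fin.insertNth_zero]

lemma mixed_le (a b : ℝ) (ha : 0 ≤ a) (hb : 0 ≤ b) (i j : ℕ) :
    a ^ i * b ^ j ≤ a ^ (i + j) + b ^ (i + j) := by
  rcases le_total a b with h | h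
  · calc a ^ i * b ^ j ≤ b ^ i * b ^ j := by gcongr
      _ = b ^ (i + j) := (pow_add _ _ _).symm
      _ ≤ _ := by linarith [pow_nonneg ha (i + j)]
  · calc a ^ i * b ^ j ≤ a ^ i * a ^ j := by gcongr
      _ = a ^ (i + j) := (pow_add _ _ _).symm
      _ ≤ _ := by linarith [pow_nonneg hb (i + j)]

/-- `(W+y)^{2(p+1)} ≤ W^{2(p+1)} + 2(p+1) W^{2p+1} y + C (W^{2p} y^2 + y^{2(p+1)})`. -/
lemma taylor_even (p : ℕ) : ∃ C : ℝ, 0 ≤ C ∧ ∀ W y : ℝ,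
    (W + y) ^ (2 * (p + 1)) ≤ W ^ (2 * (p + 1)) + 2 * (p + 1) * (W ^ (2 * p + 1) * y)
      + C * (W ^ (2 * p) * y ^ 2 + y ^ (2 * (p + 1))) := by
  induction p with
  | zero => exact ⟨1, zero_le_one, fun W y => by simp; nlinarith [sq_nonneg W, sq_nonneg y]⟩
  | succ p ih =>
    obtain ⟨C, hC, h⟩ := ih
    refine ⟨1 + 4 * (p + 1) + 2 * (p + 1) + 10 * C, by positivity, fun W y => ?_⟩
    have h1 := mul_le_mul_of_nonneg_right (h W y) (sq_nonneg (W + y))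
    have e0 : (W + y) ^ (2 * (p + 1)) * (W + y) ^ 2 = (W + y) ^ (2 * (p + 1 + 1)) := by ring
    rw [e0] at h1
    refine h1.trans ?_
    -- abbreviations
    have m1 := mixed_le (W ^ 2) (y ^ 2) (sq_nonneg _) (sq_nonneg _) p 1
    have m2 := mixed_le (W ^ 2) (y ^ 2) (sq_nonneg _) (sq_nonneg _) 1 p
    set A := (W ^ 2) ^ p with hA
    set B := (y ^ 2) ^ p with hB
    have hA0 : 0 ≤ A := by positivity
    have hB0 : 0 ≤ B := by positivity
    have eW : W ^ (2 * p) = A := by rw [hA, pow_mul]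
    have ey : y ^ (2 * p) = B := by rw [hB, pow_mul]
    have f1 : W ^ (2 * (p + 1)) = A * W ^ 2 := by rw [← eW]; ring
    have f2 : y ^ (2 * (p + 1)) = B * y ^ 2 := by rw [← ey]; ring
    have f3 : W ^ (2 * p + 1) = A * W := by rw [← eW]; ring
    have f4 : W ^ (2 * (p + 1) + 1) = A * W ^ 3 := by rw [← eW]; ring
    have f5 : W ^ (2 * (p + 1 + 1)) = A * W ^ 4 := by rw [← eW]; ring
    have f6 : y ^ (2 * (p + 1 + 1)) = B * y ^ 4 := by rw [← ey]; ring
    have g1 : (W ^ 2) ^ (p + 1) = A * W ^ 2 := by rw [hA]; ring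
    have g2 : (y ^ 2) ^ (p + 1) = B * y ^ 2 := by rw [hB]; ring
    have g3 : (W ^ 2) ^ (1 + p) = A * W ^ 2 := by rw [hA]; ring
    have g4 : (y ^ 2) ^ (1 + p) = B * y ^ 2 := by rw [hB]; ring
    rw [g1, g2, pow_one] at m1
    rw [g3, g4, pow_one] at m2
    rw [eW, f1, f2, f3, f4, f5, f6]
    push_cast
    -- T = A W^2 y^2 + B y^4
    have n1 : A * y ^ 4 ≤ A * W ^ 2 * y ^ 2 + B * y ^ 4 := by
      have := mul_le_mul_of_nonneg_right m1 (sq_nonneg y)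
      linear_combination this
    have n2 : B * y ^ 2 * W ^ 2 ≤ A * W ^ 2 * y ^ 2 + B * y ^ 4 := by
      have := mul_le_mul_of_nonneg_right m2 (sq_nonneg y)
      linear_combination this
    have n3 : 2 * (A * W * y ^ 3) ≤ A * W ^ 2 * y ^ 2 + A * y ^ 4 := by
      have := mul_nonneg hA0 (sq_nonneg (W * y - y ^ 2))
      linear_combination this
    have n4 : (W + y) ^ 2 ≤ 2 * W ^ 2 + 2 * y ^ 2 := by nlinarith [sq_nonneg (W - y)]
    have hT1 : 0 ≤ A * W ^ 2 * y ^ 2 := by positivity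
    have hT2 : 0 ≤ B * y ^ 4 := by positivity
    have n5 : (A * y ^ 2 + B * y ^ 2) * (W + y) ^ 2 ≤ 10 * (A * W ^ 2 * y ^ 2 + B * y ^ 4) := by
      calc _ ≤ (A * y ^ 2 + B * y ^ 2) * (2 * W ^ 2 + 2 * y ^ 2) := by gcongr
        _ = 2 * (A * W ^ 2 * y ^ 2) + 2 * (A * y ^ 4) + 2 * (B * y ^ 2 * W ^ 2)
            + 2 * (B * y ^ 4) := by ring
        _ ≤ _ := by linarith
    have n6 := mul_le_mul_of_nonneg_left n5 hC
    have hp : (0 : ℝ) ≤ (p : ℝ) + 1 := by positivity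
    have n7 := mul_le_mul_of_nonneg_left (n3.trans (by linarith [n1] :
      A * W ^ 2 * y ^ 2 + A * y ^ 4 ≤ 2 * (A * W ^ 2 * y ^ 2 + B * y ^ 4))) hp
    have n8 : 0 ≤ ((p : ℝ) + 1) * (B * y ^ 4) := by positivity
    linear_combination n6 + n7 + hT2 + 4 * n8

variable {η : Measure ℝ} [IsProbabilityMeasure η]

/-- all moments of `g` are finite and `g` is measurable. -/
lemma ub_sum {g : ℝ → ℝ} (hg : Measurable g) (hgi : ∀ k : ℕ, Integrable (fun x => g x ^ k) η)
    (n : ℕ) (v : Fin n → ℝ) :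
    UB (fun _ : Unit => Measure.pi fun _ : Fin n => η)
      (fun _ x => ∑ i, v i * g (x i)) := by
  have h1 : ∀ i : Fin n, UB (fun _ : Unit => Measure.pi fun _ : Fin n => η)
      (fun _ x => v i * g (x i)) := by
    intro i
    refine (UB.cst (v i)).mul ⟨fun _ => by fun_prop, fun k => ⟨_, fun _ => ⟨?_, le_rfl⟩⟩⟩
    exact (measurePreserving_eval (fun _ : Fin n => η) i).integrable_comp_of_integrable
      (hgi (2 * k))
  have h2 : ∀ s : Finset (Fin n), UB (fun _ : Unit => Measure.pi fun _ : Fin n => η)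
      (fun _ x => ∑ i ∈ s, v i * g (x i)) := by
    intro s
    induction s using Finset.induction_on with
    | empty => simpa using UB.cst (μ := fun _ : Unit => Measure.pi fun _ : Fin n => η) 0
    | insert a s ha ih =>
      simp only [Finset.sum_insert ha]
      exact (h1 a).add ih
  exact h2 univ

lemma lin_moment {g : ℝ → ℝ} (hg : Measurable g)
    (hgi : ∀ k : ℕ, Integrable (fun x => g x ^ k) η) (h0 : ∫ x, g x ∂η = 0) (p : ℕ) :
    ∃ K : ℝ, 0 ≤ K ∧ ∀ (n : ℕ) (v : Fin n → ℝ),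
      ∫ x, (∑ i, v i * g (x i)) ^ (2 * p) ∂(Measure.pi fun _ : Fin n => η)
        ≤ K * (∑ i, v i ^ 2) ^ p := by
  induction p with
  | zero => exact ⟨1, zero_le_one, fun n v => by simp⟩
  | succ p ih =>
    obtain ⟨K, hK, hKb⟩ := ih
    obtain ⟨C, hC, ht⟩ := taylor_even p
    set M := ∫ x, g x ^ (2 * (p + 1)) ∂η with hM
    have hM0 : 0 ≤ M := integral_nonneg fun x => by
      simp only [pow_mul]; positivity
    set M2 := ∫ x, g x ^ 2 ∂η with hM2
    have hM20 : 0 ≤ M2 := integral_nonneg fun x => by positivity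
    set Q := C * (K * M2 + M) with hQ
    have hQ0 : 0 ≤ Q := by positivity
    refine ⟨2 * Q, by positivity, fun n => ?_⟩
    induction n with
    | zero => intro v; simp
    | succ n ihn =>
      intro v
      set w : Fin n → ℝ := fun i => v i.succ with hw
      have hU := ub_sum hg hgi n w
      have hWk : ∀ k, Integrable (fun y : Fin n → ℝ => (∑ i, w i * g (y i)) ^ k)
        (Measure.pi fun _ : Fin n => η) := fun k => (hU.pow k).integrable ()
      have hyk : ∀ k, Integrable (fun x : ℝ => (v 0 * g x) ^ k) η := fun k => by
        simp only [mul_pow]; exact (hgi k).const_mul _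
      rw [← (mp_cons η n).map_eq, integral_map (mp_cons η n).measurable.aemeasurable
        (by
          apply Measurable.aestronglyMeasurable
          apply Measurable.pow_const
          exact Finset.measurable_sum _ fun i _ => by fun_prop)]
      simp only [Fin.sum_univ_succ, Fin.cons_zero, Fin.cons_succ]
      change ∫ q : ℝ × (Fin n → ℝ), (v 0 * g q.1 + ∑ i, w i * g (q.2 i)) ^ (2 * (p + 1))
        ∂(η.prod (Measure.pi fun _ => η)) ≤ 2 * Q * (v 0 ^ 2 + ∑ i, w i ^ 2) ^ (p + 1)
      set s := ∑ i, w i ^ 2 with hs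
      have hs0 : 0 ≤ s := Finset.sum_nonneg fun i _ => sq_nonneg _
      have hprod : ∀ k l, Integrable (fun q : ℝ × (Fin n → ℝ) =>
          (v 0 * g q.1) ^ k * (∑ i, w i * g (q.2 i)) ^ l) (η.prod (Measure.pi fun _ => η)) :=
        fun k l => (hyk k).mul_prod (hWk l)
      have hpint : ∀ k l, ∫ q : ℝ × (Fin n → ℝ),
          (v 0 * g q.1) ^ k * (∑ i, w i * g (q.2 i)) ^ l ∂(η.prod (Measure.pi fun _ => η))
          = (v 0 ^ k * ∫ x, g x ^ k ∂η)
            * ∫ y, (∑ i, w i * g (y i)) ^ l ∂(Measure.pi fun _ : Fin n => η) := by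
        intro k l
        rw [integral_prod_mul (fun x => (v 0 * g x) ^ k)
          (fun y : Fin n → ℝ => (∑ i, w i * g (y i)) ^ l)]
        simp only [mul_pow, integral_const_mul]
      have hdom : ∀ q : ℝ × (Fin n → ℝ), 
          (v 0 * g q.1 + ∑ i, w i * g (q.2 i)) ^ (2 * (p + 1)) ≤
          ((v 0 * g q.1) ^ 0 * (∑ i, w i * g (q.2 i)) ^ (2 * (p + 1))
          + 2 * (p + 1) * ((v 0 * g q.1) ^ 1 * (∑ i, w i * g (q.2 i)) ^ (2 * p + 1)))
          + C * ((v 0 * g q.1) ^ 2 * (∑ i, w i * g (q.2 i)) ^ (2 * p)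
            + (v 0 * g q.1) ^ (2 * (p + 1)) * (∑ i, w i * g (q.2 i)) ^ 0) := by
        intro q
        have := ht (∑ i, w i * g (q.2 i)) (v 0 * g q.1)
        rw [add_comm]
        refine this.trans (le_of_eq ?_)
        ring
      have hI1 := hprod 0 (2 * (p + 1))
      have hI2 := (hprod 1 (2 * p + 1)).const_mul (2 * ((p : ℝ) + 1))
      have hI3 := ((hprod 2 (2 * p)).add (hprod (2 * (p + 1)) 0)).const_mul C
      have hle : ∫ q : ℝ × (Fin n → ℝ), (v 0 * g q.1 + ∑ i, w i * g (q.2 i)) ^ (2 * (p + 1))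
        ∂(η.prod (Measure.pi fun _ => η)) ≤ _ :=
        integral_mono_of_nonneg (Eventually.of_forall fun q => by
          simp only [pow_mul, Pi.zero_apply]; positivity) ((hI1.add hI2).add hI3)
          (Eventually.of_forall hdom)
      refine hle.trans ?_
      simp only [Pi.add_apply]
      rw [integral_add (by exact hI1.add hI2) (by exact hI3), integral_add hI1 hI2,
        integral_const_mul, integral_const_mul, integral_add (hprod _ _) (hprod _ _),
        hpint, hpint, hpint, hpint]
      simp only [pow_one, h0, pow_zero, integral_const, probReal_univ, one_smul, mul_one,
        mul_zero, zero_mul, add_zero, one_mul]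
      have i1 := ihn w
      have i2 := hKb n w
      rw [← hs] at i1 i2
      rw [← hM, ← hM2]
      set x := v 0 ^ 2 with hx
      have hx0 : 0 ≤ x := sq_nonneg _
      have ev : v 0 ^ (2 * (p + 1)) = x ^ (p + 1) := by rw [hx, pow_mul]
      rw [ev]
      have j1 : s ^ (p + 1) + s ^ p * x ≤ (x + s) ^ (p + 1) := by
        calc s ^ (p + 1) + s ^ p * x = s ^ p * (x + s) := by ring
          _ ≤ (x + s) ^ p * (x + s) := by gcongr; linarith
          _ = _ := by ring
      have j2 : s ^ (p + 1) + x ^ (p + 1) ≤ (x + s) ^ (p + 1) := by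
        have := pow_add_pow_le (n := p + 1) hx0 hs0 (by omega)
        linarith
      have k1 : x * M2 * ∫ y, (∑ i, w i * g (y i)) ^ (2 * p) ∂(Measure.pi fun _ : Fin n => η)
          ≤ x * M2 * (K * s ^ p) := by gcongr
      have l1 : C * (x * M2 * (K * s ^ p) + x ^ (p + 1) * M) ≤ Q * (s ^ p * x + x ^ (p + 1)) := by
        have a1 : 0 ≤ C * (K * M2) * x ^ (p + 1) := by positivity
        have a2 : 0 ≤ C * M * (s ^ p * x) := by positivity
        rw [hQ]; nlinarith
      have l2 := mul_le_mul_of_nonneg_left k1 hC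
      have l3 := mul_le_mul_of_nonneg_left (add_le_add j1 j2) hQ0
      nlinarith

/-- Fourth moment of a standardized sum. -/
lemma sum_mom24 (hmom : ∀ n : ℕ, Integrable (fun x : ℝ => x ^ n) η)
    (hmean : ∫ x, x ∂η = 0) (hvar : ∫ x, x ^ 2 ∂η = 1) (n : ℕ) :
    (∫ x, (∑ i, x i) ^ 1 ∂(Measure.pi fun _ : Fin n => η) = 0) ∧
    (∫ x, (∑ i, x i) ^ 2 ∂(Measure.pi fun _ : Fin n => η) = n) ∧
    (∫ x, (∑ i, x i) ^ 4 ∂(Measure.pi fun _ : Fin n => η)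
      = 3 * n * (n - 1) + n * ∫ x, x ^ 4 ∂η) := by
  induction n with
  | zero => simp
  | succ n ih =>
    obtain ⟨ih1, ih2, ih4⟩ := ih
    have hU := ub_sum measurable_id hmom n (fun _ => 1)
    simp only [id, one_mul] at hU
    have hprod : ∀ k l, Integrable (fun q : ℝ × (Fin n → ℝ) =>
          q.1 ^ k * (∑ i, q.2 i) ^ l) (η.prod (Measure.pi fun _ => η)) :=
        fun k l => (hmom k).mul_prod ((hU.pow l).integrable ())
    have hpint : ∀ k l, ∫ q : ℝ × (Fin n → ℝ),
          q.1 ^ k * (∑ i, q.2 i) ^ l ∂(η.prod (Measure.pi fun _ => η))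
          = (∫ x, x ^ k ∂η) * ∫ y, (∑ i, y i) ^ l ∂(Measure.pi fun _ : Fin n => η) := by
        intro k l
        exact integral_prod_mul (fun x => x ^ k) (fun y : Fin n → ℝ => (∑ i, y i) ^ l)
    have hm : ∀ k : ℕ, ∫ x, (∑ i, x i) ^ k ∂(Measure.pi fun _ : Fin (n + 1) => η)
        = ∫ q : ℝ × (Fin n → ℝ), (q.1 + ∑ i, q.2 i) ^ k ∂(η.prod (Measure.pi fun _ => η)) := by
      intro k
      rw [← (mp_cons η n).map_eq, integral_map (mp_cons η n).measurable.aemeasurable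
        (by
          apply Measurable.aestronglyMeasurable
          apply Measurable.pow_const
          exact Finset.measurable_sum _ fun i _ => by fun_prop)]
      simp only [Fin.sum_univ_succ, Fin.cons_zero, Fin.cons_succ]
    refine ⟨?_, ?_, ?_⟩
    · rw [hm]
      have e : (fun q : ℝ × (Fin n → ℝ) => (q.1 + ∑ i, q.2 i) ^ 1) = fun q =>
        q.1 ^ 1 * (∑ i, q.2 i) ^ 0 + q.1 ^ 0 * (∑ i, q.2 i) ^ 1 := by ext q; ring
      rw [e, integral_add (hprod _ _) (hprod _ _), hpint, hpint, ih1]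
      simp [hmean]
    · rw [hm]
      have e : (fun q : ℝ × (Fin n → ℝ) => (q.1 + ∑ i, q.2 i) ^ 2) = fun q =>
        (q.1 ^ 2 * (∑ i, q.2 i) ^ 0 + 2 * (q.1 ^ 1 * (∑ i, q.2 i) ^ 1))
          + q.1 ^ 0 * (∑ i, q.2 i) ^ 2 := by ext q; ring
      rw [e, integral_add (by exact (hprod _ _).add ((hprod _ _).const_mul _)) (hprod _ _),
        integral_add (hprod _ _) ((hprod _ _).const_mul _), integral_const_mul,
        hpint, hpint, hpint, ih1, ih2]
      simp [hvar]; ring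
    · rw [hm]
      have e : (fun q : ℝ × (Fin n → ℝ) => (q.1 + ∑ i, q.2 i) ^ 4) = fun q =>
        (((q.1 ^ 4 * (∑ i, q.2 i) ^ 0 + 4 * (q.1 ^ 3 * (∑ i, q.2 i) ^ 1))
          + 6 * (q.1 ^ 2 * (∑ i, q.2 i) ^ 2)) + 4 * (q.1 ^ 1 * (∑ i, q.2 i) ^ 3))
          + q.1 ^ 0 * (∑ i, q.2 i) ^ 4 := by ext q; ring
      have I1 := hprod 4 0
      have I2 := (hprod 3 1).const_mul 4
      have I3 := (hprod 2 2).const_mul 6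
      have I4 := (hprod 1 3).const_mul 4
      rw [e, integral_add (by exact ((I1.add I2).add I3).add I4) (hprod _ _),
        integral_add (by exact (I1.add I2).add I3) I4, integral_add (by exact I1.add I2) I3,
        integral_add I1 I2, integral_const_mul, integral_const_mul, integral_const_mul,
        hpint, hpint, hpint, hpint, hpint, ih1, ih2, ih4, hvar]
      simp [hmean]; ring

end moments
section chain

/-- The chain driven by the stream `ω`. -/
def chainF {Θ E : Type} (Φ : Θ → E → Θ) (θ : Θ) (ω : ℕ → E) : ℕ → Θ
  | 0 => θ
  | l + 1 => Φ (chainF Φ θ ω l) (ω l)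

lemma chainF_succ' {Θ E : Type} (Φ : Θ → E → Θ) (θ : Θ) (ω : ℕ → E) (l : ℕ) :
    chainF Φ θ ω (l + 1) = chainF Φ (Φ θ (ω 0)) (fun n => ω (n + 1)) l := by
  induction l with
  | zero => rfl
  | succ l ih => rw [chainF, ih]; rfl

/-- Extension of a finite stream by zero. -/
def ext0 {d : ℕ} (N : ℕ) (ω : Fin N → Fin d → ℝ) : ℕ → Fin d → ℝ :=
  fun n => if h : n < N then ω ⟨n, h⟩ else fun _ => 0

lemma cons_emb {E : Type} [MeasurableSpace E] (n : ℕ) :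
    MeasurableEmbedding (fun p : E × (Fin n → E) => (Fin.cons p.1 p.2 : Fin (n + 1) → E)) := by
  have h := (MeasurableEquiv.piFinSuccAbove (fun _ : Fin (n + 1) => E) 0).symm.measurableEmbedding
  convert h using 1
  funext q
  simp [MeasurableEquiv.piFinSuccAbove, Fin.insertNthEquiv]

lemma superm {d : ℕ} {Θ : Type} (P : Measure (Fin d → ℝ)) [IsProbabilityMeasure P]
    (Φ : Θ → (Fin d → ℝ) → Θ) (N : ℕ) : ∀ (L : ℕ) (_ : L ≤ N) (G : ℕ → Θ → ENNReal)
    (_ : ∀ l, l < L → ∀ θ, ∫⁻ x, G (l + 1) (Φ θ x) ∂P ≤ G l θ) (θ : Θ),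
    ∫⁻ ω, G L (chainF Φ θ (ext0 N ω) L) ∂(Measure.pi fun _ : Fin N => P) ≤ G 0 θ := by
  induction N with
  | zero =>
    intro L hL G hG θ
    obtain rfl : L = 0 := by omega
    simp [chainF]
  | succ N ih =>
    intro L hL G hG θ
    rcases L with _ | L
    · simp [chainF]
    · rw [← (mp_cons P N).lintegral_comp_emb (cons_emb N)]
      refine (lintegral_prod_le _).trans ?_
      have key : ∀ (x : Fin d → ℝ), ∫⁻ ω, G (L + 1)
          (chainF Φ θ (ext0 (N + 1) (Fin.cons x ω : Fin (N + 1) → Fin d → ℝ)) (L + 1))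
            ∂(Measure.pi fun _ : Fin N => P) ≤ G 1 (Φ θ x) := by
        intro x
        have h1 := ih L (by omega) (fun l => G (l + 1)) (fun l hl θ => hG (l + 1) (by omega) θ)
          (Φ θ x)
        refine le_trans (le_of_eq ?_) h1
        congr 1; funext ω
        rw [chainF_succ']
        have e0 : ext0 (N + 1) (Fin.cons x ω : Fin (N + 1) → Fin d → ℝ) 0 = x := by
          simp [ext0]
        have e1 : (fun n => ext0 (N + 1) (Fin.cons x ω : Fin (N + 1) → Fin d → ℝ) (n + 1))
            = ext0 N ω := by
          funext n
          by_cases h : n < N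
          · have h' : n + 1 < N + 1 := by omega
            simp only [ext0, h, h', dif_pos]
            exact Fin.cons_succ (α := fun _ => Fin d → ℝ) x ω ⟨n, h⟩
          · simp [ext0, h]
        rw [e0, e1]
      exact (lintegral_mono key).trans (hG 0 (by omega) θ)

end chain
section onestep

/-- Squared distance to the first basis vector. -/
noncomputable def Dsq {d : ℕ} (θ : Fin d → ℝ) : ℝ :=
  ∑ i, (θ i - (if (i : ℕ) = 0 then 1 else 0)) ^ 2

/-- The normalized increment of the squared norm. -/
noncomputable def rho {n : ℕ} (c : ℝ) (θ x : Fin (n + 1) → ℝ) : ℝ :=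
  -8 * ((∑ j, x j * θ j) ^ 2 - (∑ j, x j * (Real.sqrt (n + 1))⁻¹) ^ 2) * (∑ j, x j * θ j) ^ 2
  + 16 * c * ((∑ j, x j * θ j) ^ 2 - (∑ j, x j * (Real.sqrt (n + 1))⁻¹) ^ 2) ^ 2
    * (∑ j, x j * θ j) ^ 2 * ((∑ j, x j ^ 2) / (n + 1))

/-- The normalized increment of the squared distance to the first basis vector. -/
noncomputable def drr {n : ℕ} (c : ℝ) (θ x : Fin (n + 1) → ℝ) : ℝ :=
  -8 * ((∑ j, x j * θ j) ^ 2 - (∑ j, x j * (Real.sqrt (n + 1))⁻¹) ^ 2) * (∑ j, x j * θ j)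
    * (∑ j, x j * θ j - x 0)
  + 16 * c * ((∑ j, x j * θ j) ^ 2 - (∑ j, x j * (Real.sqrt (n + 1))⁻¹) ^ 2) ^ 2
    * (∑ j, x j * θ j) ^ 2 * ((∑ j, x j ^ 2) / (n + 1))

/-- Limiting drift. -/
noncomputable def fdrift (η : Measure ℝ) (c : ℝ) : ℝ :=
  -8 * (∫ x, x ^ 4 ∂η - 1) + 16 * c * (∫ x, x ^ 6 ∂η - 2 * ∫ x, x ^ 4 ∂η + 3)

lemma ub_lin {η : Measure ℝ} [IsProbabilityMeasure η] {g : ℝ → ℝ} (hg : Measurable g)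
    (hgi : ∀ k : ℕ, Integrable (fun x => g x ^ k) η) (h0 : ∫ x, g x ∂η = 0)
    {ι : Type} (n : ι → ℕ) (v : ∀ i, Fin (n i) → ℝ) (C : ℝ)
    (hv : ∀ i, ∑ j, v i j ^ 2 ≤ C) :
    UB (fun i => Measure.pi fun _ : Fin (n i) => η) (fun i x => ∑ j, v i j * g (x j)) := by
  refine ⟨fun i => Finset.measurable_sum _ fun j _ => by fun_prop, fun k => ?_⟩
  obtain ⟨K, hK, h⟩ := lin_moment hg hgi h0 k
  refine ⟨K * C ^ k, fun i => ⟨((ub_sum hg hgi (n i) (v i)).pow (2 * k)).integrable (), ?_⟩⟩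
  refine (h _ _).trans ?_
  have : 0 ≤ ∑ j, v i j ^ 2 := Finset.sum_nonneg fun _ _ => sq_nonneg _
  gcongr
  exact hv i

lemma int_rho0 {η : Measure ℝ} [IsProbabilityMeasure η]
    (hmom : ∀ n : ℕ, Integrable (fun x : ℝ => x ^ n) η)
    (hmean : ∫ x, x ∂η = 0) (hvar : ∫ x, x ^ 2 ∂η = 1) (c : ℝ) (n : ℕ) :
    ∫ x, (-8 * (x 0 ^ 2 - ((Real.sqrt (n + 1))⁻¹ * ∑ i : Fin n, x i.succ) ^ 2) * x 0 ^ 2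
      + 16 * c * (x 0 ^ 2 - ((Real.sqrt (n + 1))⁻¹ * ∑ i : Fin n, x i.succ) ^ 2) ^ 2 * x 0 ^ 2)
        ∂(Measure.pi fun _ : Fin (n + 1) => η)
      = -8 * (∫ x, x ^ 4 ∂η - n / (n + 1)) + 16 * c * (∫ x, x ^ 6 ∂η
        - 2 * (∫ x, x ^ 4 ∂η) * (n / (n + 1))
        + (3 * n * (n - 1) + n * ∫ x, x ^ 4 ∂η) / (n + 1) ^ 2) := by
  have hU := ub_sum measurable_id hmom n (fun _ => 1)
  simp only [id, one_mul] at hU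
  have hprod : ∀ k l, Integrable (fun q : ℝ × (Fin n → ℝ) =>
        q.1 ^ k * (∑ i, q.2 i) ^ l) (η.prod (Measure.pi fun _ => η)) :=
      fun k l => (hmom k).mul_prod ((hU.pow l).integrable ())
  have hpint : ∀ k l, ∫ q : ℝ × (Fin n → ℝ),
        q.1 ^ k * (∑ i, q.2 i) ^ l ∂(η.prod (Measure.pi fun _ => η))
        = (∫ x, x ^ k ∂η) * ∫ y, (∑ i, y i) ^ l ∂(Measure.pi fun _ : Fin n => η) := by
      intro k l
      exact integral_prod_mul (fun x => x ^ k) (fun y : Fin n → ℝ => (∑ i, y i) ^ l)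
  obtain ⟨s1, s2, s4⟩ := sum_mom24 hmom hmean hvar n
  rw [← (mp_cons η n).integral_comp (cons_emb n)]
  simp only [Fin.cons_zero, Fin.cons_succ]
  set r : ℝ := (Real.sqrt (n + 1))⁻¹ with hr
  have hr2 : r ^ 2 = 1 / (n + 1) := by
    rw [hr, inv_pow, Real.sq_sqrt (by positivity), one_div]
  have hr4 : r ^ 4 = 1 / (n + 1) ^ 2 := by
    rw [show r ^ 4 = (r ^ 2) ^ 2 by ring, hr2]; field_simp
  have e : ∀ q : ℝ × (Fin n → ℝ), -8 * (q.1 ^ 2 - (r * ∑ i, q.2 i) ^ 2) * q.1 ^ 2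
      + 16 * c * (q.1 ^ 2 - (r * ∑ i, q.2 i) ^ 2) ^ 2 * q.1 ^ 2
      = (((-8 * (q.1 ^ 4 * (∑ i, q.2 i) ^ 0) + 16 * c * (q.1 ^ 6 * (∑ i, q.2 i) ^ 0))
        + 8 * r ^ 2 * (q.1 ^ 2 * (∑ i, q.2 i) ^ 2)) + -32 * c * r ^ 2 * (q.1 ^ 4 * (∑ i, q.2 i) ^ 2))
        + 16 * c * r ^ 4 * (q.1 ^ 2 * (∑ i, q.2 i) ^ 4) := by
    intro q; ring
  simp only [e]
  have I1 := (hprod 4 0).const_mul (-8)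
  have I2 := (hprod 6 0).const_mul (16 * c)
  have I3 := (hprod 2 2).const_mul (8 * r ^ 2)
  have I4 := (hprod 4 2).const_mul (-32 * c * r ^ 2)
  have I5 := (hprod 2 4).const_mul (16 * c * r ^ 4)
  rw [integral_add (by exact ((I1.add I2).add I3).add I4) I5,
    integral_add (by exact (I1.add I2).add I3) I4, integral_add (by exact I1.add I2) I3,
    integral_add I1 I2]
  simp only [integral_const_mul, hpint, s2, s4, hvar, hr2, hr4]
  simp
  field_simp
  ring

lemma sum_fin_e1 {n : ℕ} (x : Fin (n + 1) → ℝ) :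
    ∑ j : Fin (n + 1), (if (j : ℕ) = 0 then (1 : ℝ) else 0) * x j = x 0 := by
  simp

set_option maxHeartbeats 1000000 in
lemma onestep {η : Measure ℝ} [IsProbabilityMeasure η]
    (hmom : ∀ n : ℕ, Integrable (fun x : ℝ => x ^ n) η)
    (hmean : ∫ x, x ∂η = 0) (hvar : ∫ x, x ^ 2 ∂η = 1) (c : ℝ) :
    ∃ K : ℝ, 0 ≤ K ∧ ∃ ε : ℕ → ℝ, Tendsto ε atTop (nhds 0) ∧ (∀ n, 0 ≤ ε n) ∧
      ∀ (n : ℕ) (θ : Fin (n + 1) → ℝ), Dsq θ ≤ 1 →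
        Integrable (drr c θ) (Measure.pi fun _ => η) ∧
        ∫ x, drr c θ x ∂(Measure.pi fun _ => η) ≤ K ∧
        Integrable (rho c θ) (Measure.pi fun _ => η) ∧
        Integrable (fun x => rho c θ x ^ 2) (Measure.pi fun _ => η) ∧
        (∫ x, rho c θ x ∂(Measure.pi fun _ => η) - fdrift η c) ^ 2 ≤ K * Dsq θ + ε n ∧
        ∫ x, (rho c θ x - fdrift η c) ^ 2 ∂(Measure.pi fun _ => η) ≤ K := by
  let ι := Σ n : ℕ, {θ : Fin (n + 1) → ℝ // Dsq θ ≤ 1}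
  let μ : ∀ i : ι, Measure (Fin (i.1 + 1) → ℝ) := fun i => Measure.pi fun _ => η
  let s : ι → ℝ := fun i => (Real.sqrt (i.1 + 1))⁻¹
  have hs0 : ∀ i, 0 ≤ s i := fun i => by positivity
  have hs2 : ∀ i, s i ^ 2 = 1 / ((i.1 : ℝ) + 1) := fun i => by
    simp only [s]; rw [inv_pow, Real.sq_sqrt (by positivity), one_div]
  have hs21 : ∀ i, s i ^ 2 ≤ 1 := fun i => by
    rw [hs2, div_le_one (by positivity)]; linarith [(Nat.cast_nonneg i.1 : (0 : ℝ) ≤ i.1)]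
  have hidk : ∀ k : ℕ, Integrable (fun x : ℝ => (id x) ^ k) η := hmom
  have hid0 : ∫ x, id x ∂η = 0 := hmean
  -- the second centered function
  have hgm : Measurable (fun x : ℝ => x ^ 2 - 1) := by fun_prop
  have hgk : ∀ k : ℕ, Integrable (fun x : ℝ => (x ^ 2 - 1) ^ k) η := by
    have hU : UB (fun _ : Unit => η) (fun _ x => x) :=
      ⟨fun _ => measurable_id, fun k => ⟨_, fun _ => ⟨hmom (2 * k), le_rfl⟩⟩⟩
    intro k
    exact (((hU.pow 2).sub (UB.cst 1)).pow k).integrable ()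
  have hg0 : ∫ x : ℝ, (x ^ 2 - 1) ∂η = 0 := by
    rw [integral_sub (hmom 2) (integrable_const 1), hvar]; simp
  -- basic families
  let X : ∀ i : ι, (Fin (i.1 + 1) → ℝ) → ℝ := fun i x => x 0
  let A : ∀ i : ι, (Fin (i.1 + 1) → ℝ) → ℝ := fun i x => ∑ j, x j * i.2.1 j
  let B : ∀ i : ι, (Fin (i.1 + 1) → ℝ) → ℝ := fun i x => ∑ j, x j * s i
  let B' : ∀ i : ι, (Fin (i.1 + 1) → ℝ) → ℝ := fun i x => s i * ∑ j : Fin i.1, x j.succ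
  let Z : ∀ i : ι, (Fin (i.1 + 1) → ℝ) → ℝ := fun i x => A i x - X i x
  let H : ∀ i : ι, (Fin (i.1 + 1) → ℝ) → ℝ := fun i x => s i * X i x
  let NN : ∀ i : ι, (Fin (i.1 + 1) → ℝ) → ℝ := fun i x => (∑ j, x j ^ 2) / ((i.1 : ℝ) + 1)
  let Y : ∀ i : ι, (Fin (i.1 + 1) → ℝ) → ℝ := fun i x => NN i x - 1
  have eX : X = fun i x => ∑ j : Fin (i.1 + 1), (if (j : ℕ) = 0 then (1 : ℝ) else 0) * id (x j) := by
    funext i x; exact (sum_fin_e1 x).symm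
  have eZ : Z = fun i x => ∑ j : Fin (i.1 + 1),
      (i.2.1 j - if (j : ℕ) = 0 then (1 : ℝ) else 0) * id (x j) := by
    funext i x
    simp only [sub_mul, Finset.sum_sub_distrib, id]
    rw [sum_fin_e1 x]
    simp only [Z, A, X, mul_comm]
  have eB : B = fun i x => ∑ j : Fin (i.1 + 1), s i * id (x j) := by
    funext i x; simp only [B, id, mul_comm]
  have eY : Y = fun i x => ∑ j : Fin (i.1 + 1), (s i ^ 2) * (x j ^ 2 - 1) := by
    funext i x
    rw [← Finset.mul_sum, Finset.sum_sub_distrib, hs2]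
    simp only [Y, NN, Finset.sum_const, Finset.card_univ, Fintype.card_fin, nsmul_eq_mul, mul_one]
    push_cast
    field_simp
  have hUX : UB μ X := by
    rw [eX]; refine ub_lin measurable_id hidk hid0 (fun i : ι => i.1 + 1) _ 1 fun i => ?_
    simp [Fin.sum_univ_succ]
  have hUZ : UB μ Z := by
    rw [eZ]; exact ub_lin measurable_id hidk hid0 (fun i : ι => i.1 + 1) _ 1 fun i => i.2.2
  have hUB : UB μ B := by
    rw [eB]; refine ub_lin measurable_id hidk hid0 (fun i : ι => i.1 + 1) _ 1 fun i => ?_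
    rw [Finset.sum_const, hs2]; simp; field_simp; rfl
  have hUY : UB μ Y := by
    rw [eY]; refine ub_lin hgm hgk hg0 (fun i : ι => i.1 + 1) _ 1 fun i => ?_
    rw [Finset.sum_const, hs2]; simp
    have : (1 : ℝ) ≤ (i.1 : ℝ) + 1 := by linarith [(Nat.cast_nonneg i.1 : (0 : ℝ) ≤ i.1)]
    field_simp; exact this
  have hUs : UB μ (fun i _ => s i) := UB.const s 1 fun i => by
    rw [abs_of_nonneg (hs0 i)]; nlinarith [hs0 i, hs21 i]
  have hUH : UB μ H := hUs.mul hUX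
  have eB' : B' = fun i x => B i x - H i x := by
    funext i x
    simp only [B', B, H, X, Fin.sum_univ_succ, ← Finset.sum_mul]; ring
  have hUB' : UB μ B' := by rw [eB']; exact hUB.sub hUH
  have eA : A = fun i x => X i x + Z i x := by funext i x; simp only [Z]; ring
  have hUA : UB μ A := by rw [eA]; exact hUX.add hUZ
  have eN : NN = fun i x => 1 + Y i x := by funext i x; simp only [Y]; ring
  have hUN : UB μ NN := by rw [eN]; exact (UB.cst 1).add hUY
  have hAB := (hUA.pow 2).sub (hUB.pow 2)
  have hUd : UB μ (fun i x => drr c i.2.1 x) :=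
    ((((UB.cst (-8)).mul hAB).mul hUA).mul hUZ).add
      ((((UB.cst (16 * c)).mul (hAB.pow 2)).mul (hUA.pow 2)).mul hUN)
  have hUr : UB μ (fun i x => rho c i.2.1 x) :=
    (((UB.cst (-8)).mul hAB).mul (hUA.pow 2)).add
      ((((UB.cst (16 * c)).mul (hAB.pow 2)).mul (hUA.pow 2)).mul hUN)
  -- reference increment
  let R0 : ∀ i : ι, (Fin (i.1 + 1) → ℝ) → ℝ := fun i x =>
    -8 * (X i x ^ 2 - B' i x ^ 2) * X i x ^ 2 + 16 * c * (X i x ^ 2 - B' i x ^ 2) ^ 2 * X i x ^ 2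
  have hXB := (hUX.pow 2).sub (hUB'.pow 2)
  have hUR0 : UB μ R0 := (((UB.cst (-8)).mul hXB).mul (hUX.pow 2)).add
      (((UB.cst (16 * c)).mul (hXB.pow 2)).mul (hUX.pow 2))
  let Q1 : ∀ i : ι, (Fin (i.1 + 1) → ℝ) → ℝ := fun i x =>
    (A i x + X i x) * (-8 * (A i x ^ 2 + X i x ^ 2 - B i x ^ 2)
      + 16 * c * ((A i x ^ 4 + A i x ^ 2 * X i x ^ 2 + X i x ^ 4)
        - 2 * (A i x ^ 2 + X i x ^ 2) * B i x ^ 2 + B i x ^ 4))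
  let Q2 : ∀ i : ι, (Fin (i.1 + 1) → ℝ) → ℝ := fun i x =>
    (B i x + B' i x) * (8 * X i x ^ 2
      + 16 * c * (-2 * X i x ^ 4 + X i x ^ 2 * (B i x ^ 2 + B' i x ^ 2)))
  let Q3 : ∀ i : ι, (Fin (i.1 + 1) → ℝ) → ℝ := fun i x =>
    16 * c * (A i x ^ 2 - B i x ^ 2) ^ 2 * A i x ^ 2
  have hQ1 : UB μ Q1 := (hUA.add hUX).mul (((UB.cst (-8)).mul
    (((hUA.pow 2).add (hUX.pow 2)).sub (hUB.pow 2))).add ((UB.cst (16 * c)).mul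
    (((((hUA.pow 4).add ((hUA.pow 2).mul (hUX.pow 2))).add (hUX.pow 4)).sub
      (((UB.cst 2).mul ((hUA.pow 2).add (hUX.pow 2))).mul (hUB.pow 2))).add (hUB.pow 4))))
  have hQ2 : UB μ Q2 := (hUB.add hUB').mul (((UB.cst 8).mul (hUX.pow 2)).add
    ((UB.cst (16 * c)).mul (((UB.cst (-2)).mul (hUX.pow 4)).add
      ((hUX.pow 2).mul ((hUB.pow 2).add (hUB'.pow 2))))))
  have hQ3 : UB μ Q3 := ((UB.cst (16 * c)).mul (hAB.pow 2)).mul (hUA.pow 2)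
  have hdec : ∀ i x, rho c i.2.1 x = ((R0 i x + Z i x * Q1 i x) + H i x * Q2 i x)
      + Y i x * Q3 i x := by
    intro i x
    have h1 : rho c i.2.1 x = -8 * (A i x ^ 2 - B i x ^ 2) * A i x ^ 2
      + 16 * c * (A i x ^ 2 - B i x ^ 2) ^ 2 * A i x ^ 2 * NN i x := rfl
    have h2 : A i x = X i x + Z i x := by rw [eA]
    have h3 : B i x = B' i x + H i x := by rw [eB']; ring
    have h4 : NN i x = 1 + Y i x := by rw [eN]
    simp only [h1, R0, Q1, Q2, Q3, h2, h3, h4]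
    ring
  obtain ⟨Kd, hKd0, hKd⟩ := hUd.bound
  obtain ⟨Kr, hKr0, hKr⟩ := ((hUr.sub (UB.cst (fdrift η c))).pow 2).bound
  obtain ⟨K1, hK10, hK1⟩ := (hQ1.pow 2).bound
  obtain ⟨K2, hK20, hK2⟩ := (hQ2.pow 2).bound
  obtain ⟨K3, hK30, hK3⟩ := (hQ3.pow 2).bound
  obtain ⟨Ml, hMl0, hMl⟩ := lin_moment measurable_id hidk hid0 1
  obtain ⟨Mg, hMg0, hMg⟩ := lin_moment hgm hgk hg0 1
  obtain ⟨KX, hKX0, hKX⟩ := (hUX.pow 2).bound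
  let τ : ℕ → ℝ := fun n => (-8 * (∫ x, x ^ 4 ∂η - n / (n + 1)) + 16 * c * (∫ x, x ^ 6 ∂η
        - 2 * (∫ x, x ^ 4 ∂η) * (n / (n + 1))
        + (3 * n * (n - 1) + n * ∫ x, x ^ 4 ∂η) / (n + 1) ^ 2)) - fdrift η c
  have hτ : Tendsto τ atTop (nhds 0) := by
    have t1 : Tendsto (fun n : ℕ => (n : ℝ) / ((n : ℝ) + 1)) atTop (nhds 1) :=
      tendsto_natCast_div_add_atTop 1
    have t2 : Tendsto (fun n : ℕ => 1 / ((n : ℝ) + 1)) atTop (nhds 0) :=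
      tendsto_one_div_add_atTop_nhds_zero_nat
    have e : τ = fun n : ℕ => (-8 * (∫ x, x ^ 4 ∂η - (n : ℝ) / ((n : ℝ) + 1))
        + 16 * c * (∫ x, x ^ 6 ∂η - 2 * (∫ x, x ^ 4 ∂η) * ((n : ℝ) / ((n : ℝ) + 1))
        + (3 * ((n : ℝ) / ((n : ℝ) + 1)) ^ 2 + (∫ x, x ^ 4 ∂η - 3) * (((n : ℝ) / ((n : ℝ) + 1))
          * (1 / ((n : ℝ) + 1)))))) - fdrift η c := by
      funext n
      simp only [τ]
      have : ((n : ℝ) + 1) ≠ 0 := by positivity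
      field_simp
      ring
    rw [e]
    have t3 := (((t1.const_sub (∫ x, x ^ 4 ∂η)).const_mul (-8)).add
      ((((t1.const_mul (2 * ∫ x, x ^ 4 ∂η)).const_sub (∫ x, x ^ 6 ∂η)).add
        (((t1.pow 2).const_mul 3).add ((t1.mul t2).const_mul (∫ x, x ^ 4 ∂η - 3)))).const_mul
          (16 * c))).sub_const (fdrift η c)
    convert t3 using 2
    simp only [fdrift]; ring
  refine ⟨Kd + Kr + 4 * (Ml * K1), by positivity,
    fun n => 4 * ((KX * K2) * (1 / ((n : ℝ) + 1)) + (Mg * K3) * (1 / ((n : ℝ) + 1)) + τ n ^ 2),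
    ?_, ?_, ?_⟩
  · have t2 : Tendsto (fun n : ℕ => 1 / ((n : ℝ) + 1)) atTop (nhds 0) :=
      tendsto_one_div_add_atTop_nhds_zero_nat
    have := (((t2.const_mul (KX * K2)).add (t2.const_mul (Mg * K3))).add (hτ.pow 2)).const_mul 4
    simpa using this
  · intro n; positivity
  · intro n θ hθ
    let i : ι := ⟨n, θ, hθ⟩
    have hD0 : 0 ≤ Dsq θ := Finset.sum_nonneg fun _ _ => sq_nonneg _
    refine ⟨hUd.integrable i, ?_, hUr.integrable i, (hUr.pow 2).integrable i, ?_, ?_⟩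
    · have := hKd i
      have h2 : 0 ≤ 4 * (Ml * K1) := by positivity
      linarith
    · have hZQ := (hUZ.mul hQ1).integrable i
      have hHQ := (hUH.mul hQ2).integrable i
      have hYQ := (hUY.mul hQ3).integrable i
      have e1 : ∫ x, rho c θ x ∂(μ i) = ((∫ x, R0 i x ∂(μ i) + ∫ x, Z i x * Q1 i x ∂(μ i))
          + ∫ x, H i x * Q2 i x ∂(μ i)) + ∫ x, Y i x * Q3 i x ∂(μ i) := by
        rw [← integral_add (hUR0.integrable i) hZQ,
          ← integral_add (by exact (hUR0.integrable i).add hZQ) hHQ,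
          ← integral_add (by exact ((hUR0.integrable i).add hZQ).add hHQ) hYQ]
        exact integral_congr_ae (Eventually.of_forall fun x => hdec i x)
      have e2 : ∫ x, R0 i x ∂(μ i) - fdrift η c = τ n := by
        simp only [τ]; rw [← int_rho0 hmom hmean hvar c n]
      have c1 := cs_int ((hUZ.pow 2).integrable i) ((hQ1.pow 2).integrable i) hZQ
      have c2 := cs_int ((hUH.pow 2).integrable i) ((hQ2.pow 2).integrable i) hHQ
      have c3 := cs_int ((hUY.pow 2).integrable i) ((hQ3.pow 2).integrable i) hYQ
      have b1 : ∫ x, Z i x ^ 2 ∂(μ i) ≤ Ml * Dsq θ := by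
        have := hMl (n + 1) (fun j => θ j - if (j : ℕ) = 0 then (1 : ℝ) else 0)
        rw [pow_one] at this
        rw [eZ]; exact this
      have b2 : ∫ x, H i x ^ 2 ∂(μ i) ≤ KX * (1 / ((n : ℝ) + 1)) := by
        have : ∫ x, H i x ^ 2 ∂(μ i) = s i ^ 2 * ∫ x, X i x ^ 2 ∂(μ i) := by
          rw [← integral_const_mul]; simp only [H, mul_pow]
        rw [this, hs2, mul_comm]
        exact mul_le_mul_of_nonneg_right (hKX i) (by positivity)
      have b3 : ∫ x, Y i x ^ 2 ∂(μ i) ≤ Mg * (1 / ((n : ℝ) + 1)) := by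
        have := hMg (n + 1) (fun _ => s i ^ 2)
        rw [pow_one] at this
        rw [eY]
        refine this.trans (le_of_eq ?_)
        congr 1
        rw [Finset.sum_const, hs2]
        simp only [Finset.card_univ, Fintype.card_fin, nsmul_eq_mul]
        push_cast
        have : ((n : ℝ) + 1) ≠ 0 := by positivity
        change ((n : ℝ) + 1) * (1 / ((n : ℝ) + 1)) ^ 2 = _
        field_simp
      have n1 : 0 ≤ ∫ x, Q1 i x ^ 2 ∂(μ i) := integral_nonneg fun _ => sq_nonneg _
      have n2 : 0 ≤ ∫ x, Q2 i x ^ 2 ∂(μ i) := integral_nonneg fun _ => sq_nonneg _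
      have n3 : 0 ≤ ∫ x, Q3 i x ^ 2 ∂(μ i) := integral_nonneg fun _ => sq_nonneg _
      have d1 := c1.trans (mul_le_mul b1 (hK1 i) n1 (by positivity))
      have d2 := c2.trans (mul_le_mul b2 (hK2 i) n2 (by positivity))
      have d3 := c3.trans (mul_le_mul b3 (hK3 i) n3 (by positivity))
      change (∫ x, rho c θ x ∂(μ i) - fdrift η c) ^ 2 ≤ _
      have e3 : ∫ x, rho c θ x ∂(μ i) - fdrift η c = ((τ n + ∫ x, Z i x * Q1 i x ∂(μ i))
          + ∫ x, H i x * Q2 i x ∂(μ i)) + ∫ x, Y i x * Q3 i x ∂(μ i) := by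
        rw [e1, ← e2]; ring
      rw [e3]
      have four : ∀ a b c d : ℝ, (a + b + c + d) ^ 2 ≤ 4 * (a ^ 2 + b ^ 2 + c ^ 2 + d ^ 2) := by
        intro a b c d
        nlinarith [sq_nonneg (a - b), sq_nonneg (a - c), sq_nonneg (a - d), sq_nonneg (b - c),
          sq_nonneg (b - d), sq_nonneg (c - d)]
      refine (four _ _ _ _).trans ?_
      have hx : 0 ≤ (Kd + Kr) * Dsq θ := by positivity
      beta_reduce
      linear_combination 4 * d1 + 4 * d2 + 4 * d3 + hx
    · have := hKr i
      have h2 : 0 ≤ 4 * (Ml * K1) := by positivity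
      change ∫ x, (rho c θ x - fdrift η c) ^ 2 ∂(μ i) ≤ _
      linarith

end onestep
section process

/-- The first basis vector. -/
noncomputable def e1v (n : ℕ) : Fin (n + 1) → ℝ := fun i => if (i : ℕ) = 0 then 1 else 0

/-- SGD step frozen outside the unit ball around the first basis vector. -/
noncomputable def stepT {n : ℕ} (c : ℝ) (θ x : Fin (n + 1) → ℝ) : Fin (n + 1) → ℝ :=
  if Dsq θ ≤ 1 then
    sgdPRStep (c / ((n : ℝ) + 1)) (fun _ => (Real.sqrt ((n : ℝ) + 1))⁻¹) θ x
  else θ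

lemma Dsq_nonneg {d : ℕ} (θ : Fin d → ℝ) : 0 ≤ Dsq θ :=
  Finset.sum_nonneg fun _ _ => sq_nonneg _

lemma Dsq_e1v (n : ℕ) : Dsq (e1v n) = 0 := by simp [Dsq, e1v]

lemma Rsq_e1v (n : ℕ) : ∑ i, e1v n i ^ 2 = 1 := by simp [e1v]

lemma sq_step {n : ℕ} (θ x e : Fin n → ℝ) (k : ℝ) :
    ∑ i, (θ i - k * x i - e i) ^ 2 = ∑ i, (θ i - e i) ^ 2
      - 2 * k * (∑ i, x i * θ i - ∑ i, x i * e i) + k ^ 2 * ∑ i, x i ^ 2 := by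
  rw [← Finset.sum_sub_distrib, Finset.mul_sum, Finset.mul_sum, ← Finset.sum_sub_distrib,
    ← Finset.sum_add_distrib]
  exact Finset.sum_congr rfl fun i _ => by ring

lemma Dsq_step {n : ℕ} (c : ℝ) (θ x : Fin (n + 1) → ℝ) :
    Dsq (sgdPRStep (c / ((n : ℝ) + 1)) (fun _ => (Real.sqrt ((n : ℝ) + 1))⁻¹) θ x)
      = Dsq θ + c / ((n : ℝ) + 1) * drr c θ x := by
  have h := sq_step θ x (fun i => if (i : ℕ) = 0 then (1 : ℝ) else 0)
    (c / ((n : ℝ) + 1) * (4 * ((∑ j, x j * θ j) ^ 2 - (∑ j, x j * (Real.sqrt ((n : ℝ) + 1))⁻¹) ^ 2)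
      * ∑ j, x j * θ j))
  have h0 : ∑ i : Fin (n + 1), x i * (if (i : ℕ) = 0 then (1 : ℝ) else 0) = x 0 := by
    rw [← sum_fin_e1 x]; simp only [mul_comm]
  rw [h0] at h
  have hn : (n : ℝ) + 1 ≠ 0 := by positivity
  have : Dsq (sgdPRStep (c / ((n : ℝ) + 1)) (fun _ => (Real.sqrt ((n : ℝ) + 1))⁻¹) θ x) = _ :=
    Eq.trans (by simp only [Dsq, sgdPRStep, mul_assoc]) h
  rw [this, drr, ← Dsq]
  generalize (∑ j, x j * θ j) = a
  generalize (∑ j, x j * (Real.sqrt ((n : ℝ) + 1))⁻¹) = b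
  field_simp
  ring

lemma Rsq_step {n : ℕ} (c : ℝ) (θ x : Fin (n + 1) → ℝ) :
    ∑ i, (sgdPRStep (c / ((n : ℝ) + 1)) (fun _ => (Real.sqrt ((n : ℝ) + 1))⁻¹) θ x) i ^ 2
      = ∑ i, θ i ^ 2 + c / ((n : ℝ) + 1) * rho c θ x := by
  have h := sq_step θ x (fun i => 0)
    (c / ((n : ℝ) + 1) * (4 * ((∑ j, x j * θ j) ^ 2 - (∑ j, x j * (Real.sqrt ((n : ℝ) + 1))⁻¹) ^ 2)
      * ∑ j, x j * θ j))
  simp only [sub_zero, mul_zero, Finset.sum_const_zero] at h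
  have hn : (n : ℝ) + 1 ≠ 0 := by positivity
  have : ∑ i, (sgdPRStep (c / ((n : ℝ) + 1)) (fun _ => (Real.sqrt ((n : ℝ) + 1))⁻¹) θ x) i ^ 2
      = _ := Eq.trans (by simp only [sgdPRStep, mul_assoc]) h
  rw [this, rho]
  generalize (∑ j, x j * θ j) = a
  generalize (∑ j, x j * (Real.sqrt ((n : ℝ) + 1))⁻¹) = b
  field_simp
  ring

lemma chain_eq_sgd {n : ℕ} (c : ℝ) (ω : ℕ → Fin (n + 1) → ℝ) (l : ℕ)
    (h : Dsq (chainF (stepT c) (e1v n) ω l) ≤ 1) :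
    chainF (stepT c) (e1v n) ω l
      = sgdPR (c / ((n : ℝ) + 1)) (fun _ => (Real.sqrt ((n : ℝ) + 1))⁻¹) (e1v n) ω l := by
  induction l with
  | zero => rfl
  | succ l ih =>
    by_cases h1 : Dsq (chainF (stepT c) (e1v n) ω l) ≤ 1
    · rw [chainF, stepT, if_pos h1, sgdPR, ih h1]
    · rw [chainF, stepT, if_neg h1] at h
      exact absurd h h1

lemma measurable_Dsq {d : ℕ} : Measurable (Dsq : (Fin d → ℝ) → ℝ) := by
  unfold Dsq
  exact Finset.measurable_sum _ fun i _ => by fun_prop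

lemma measurable_chain {n : ℕ} (c : ℝ) (N l : ℕ) :
    Measurable (fun ω : Fin N → Fin (n + 1) → ℝ =>
      chainF (stepT c) (e1v n) (ext0 N ω) l) := by
  induction l with
  | zero => exact measurable_const
  | succ l ih =>
    have hx : Measurable (fun ω : Fin N → Fin (n + 1) → ℝ => ext0 N ω l) := by
      by_cases h : l < N
      · simp only [ext0, h, dif_pos]; fun_prop
      · simp only [ext0, h, dif_neg, not_false_eq_true]; exact measurable_const
    simp only [chainF, stepT]
    refine Measurable.ite (measurableSet_le (measurable_Dsq.comp ih) measurable_const) ?_ ih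
    have hxi : ∀ i, Measurable (fun ω : Fin N → Fin (n + 1) → ℝ => ext0 N ω l i) :=
      fun i => (measurable_pi_apply i).comp hx
    have hti : ∀ i, Measurable (fun ω : Fin N → Fin (n + 1) → ℝ =>
        chainF (stepT c) (e1v n) (ext0 N ω) l i) := fun i => (measurable_pi_apply i).comp ih
    refine measurable_pi_lambda _ fun i => ?_
    simp only [sgdPRStep]
    have hs : Measurable (fun ω : Fin N → Fin (n + 1) → ℝ =>
        ∑ j, ext0 N ω l j * chainF (stepT c) (e1v n) (ext0 N ω) l j) :=
      Finset.measurable_sum _ fun j _ => (hxi j).mul (hti j)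
    have hs2 : Measurable (fun ω : Fin N → Fin (n + 1) → ℝ =>
        ∑ j, ext0 N ω l j * (Real.sqrt ((n : ℝ) + 1))⁻¹) :=
      Finset.measurable_sum _ fun j _ => (hxi j).mul_const _
    exact (hti i).sub (((((hs.pow_const 2).sub (hs2.pow_const 2)).const_mul 4).mul hs).mul
      (hxi i) |>.const_mul _)

/-- Expected squared distance to the initialization. -/
lemma lyapD {η : Measure ℝ} [IsProbabilityMeasure η] {n : ℕ} {c K : ℝ} (hc : 0 < c) (hK : 0 ≤ K)
    (h1 : ∀ θ : Fin (n + 1) → ℝ, Dsq θ ≤ 1 →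
        Integrable (drr c θ) (Measure.pi fun _ => η) ∧
        ∫ x, drr c θ x ∂(Measure.pi fun _ => η) ≤ K) (N L : ℕ) (hL : L ≤ N) :
    ∫⁻ ω, ENNReal.ofReal (Dsq (chainF (stepT c) (e1v n) (ext0 N ω) L))
      ∂(Measure.pi fun _ : Fin N => Measure.pi fun _ : Fin (n + 1) => η)
      ≤ ENNReal.ofReal (K * (c / ((n : ℝ) + 1)) * L) := by
  set δ := c / ((n : ℝ) + 1) with hδ
  have hδ0 : 0 < δ := by positivity
  have := superm (Measure.pi fun _ : Fin (n + 1) => η) (stepT c) N L hL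
    (fun l θ => ENNReal.ofReal (Dsq θ + K * δ * ((L : ℝ) - l))) (fun l hl θ => by
      have hl' : (l : ℝ) + 1 ≤ L := by exact_mod_cast hl
      push_cast
      by_cases hD : Dsq θ ≤ 1
      · obtain ⟨hi, hb⟩ := h1 θ hD
        simp only [stepT, if_pos hD, Dsq_step]
        simp only [← hδ]
        rw [← ofReal_integral_eq_lintegral_ofReal]
        · apply ENNReal.ofReal_le_ofReal
          rw [integral_add (by exact (integrable_const _).add (hi.const_mul δ)) (integrable_const _),
            integral_add (integrable_const _) (hi.const_mul δ), integral_const_mul]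
          simp only [integral_const, probReal_univ, one_smul]
          nlinarith
        · exact ((integrable_const _).add (hi.const_mul δ)).add (integrable_const _)
        · refine Eventually.of_forall fun x => ?_
          have e := Dsq_nonneg (sgdPRStep (c / ((n : ℝ) + 1))
            (fun _ => (Real.sqrt ((n : ℝ) + 1))⁻¹) θ x)
          rw [Dsq_step, ← hδ] at e
          have : 0 ≤ K * δ * ((L : ℝ) - (l + 1)) :=
            mul_nonneg (by positivity) (by linarith)
          exact add_nonneg e this
      · simp only [stepT, if_neg hD, lintegral_const, measure_univ, mul_one]
        apply ENNReal.ofReal_le_ofReal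
        have : 0 ≤ K * δ := by positivity
        nlinarith) (e1v n)
  simpa [Dsq_e1v] using this

lemma amgm {δ t S r : ℝ} (hδ : 0 < δ) (ht : 0 < t) :
    2 * S * δ * r ≤ δ / t * S ^ 2 + δ * t * r ^ 2 := by
  have h : 0 ≤ δ / t * (S - t * r) ^ 2 := by positivity
  have e : δ / t * (S - t * r) ^ 2 = δ / t * S ^ 2 + δ * t * r ^ 2 - 2 * S * δ * r := by
    field_simp; ring
  linarith

lemma lyapS {η : Measure ℝ} [IsProbabilityMeasure η] {n : ℕ} {c K ε f t : ℝ} (hc : 0 < c)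
    (hK : 0 ≤ K) (hε : 0 ≤ ε) (ht : 0 < t) (hf : f ^ 2 ≤ K)
    (h1 : ∀ θ : Fin (n + 1) → ℝ, Dsq θ ≤ 1 →
        Integrable (drr c θ) (Measure.pi fun _ => η) ∧
        ∫ x, drr c θ x ∂(Measure.pi fun _ => η) ≤ K ∧
        Integrable (rho c θ) (Measure.pi fun _ => η) ∧
        Integrable (fun x => rho c θ x ^ 2) (Measure.pi fun _ => η) ∧
        (∫ x, rho c θ x ∂(Measure.pi fun _ => η) - f) ^ 2 ≤ K * Dsq θ + ε ∧
        ∫ x, (rho c θ x - f) ^ 2 ∂(Measure.pi fun _ => η) ≤ K)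
    (N L : ℕ) (hL : L ≤ N) (δ : ℝ) (hδ : δ = c / ((n : ℝ) + 1)) :
    ∫⁻ ω, ENNReal.ofReal ((∑ i, chainF (stepT c) (e1v n) (ext0 N ω) L i ^ 2 - 1 - L * δ * f) ^ 2)
      ∂(Measure.pi fun _ : Fin N => Measure.pi fun _ : Fin (n + 1) => η)
      ≤ ENNReal.ofReal ((1 + δ / t) ^ L *
        (L * ((δ * t * ε + δ ^ 2 * K) + L * (δ * t * K) * K * δ))) := by
  have hδ0 : 0 < δ := by rw [hδ]; positivity
  set q := 1 + δ / t with hq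
  have hq1 : 1 ≤ q := by rw [hq]; linarith [div_pos hδ0 ht]
  set κ := δ * t * K with hκ
  have hκ0 : 0 ≤ κ := by positivity
  set β := δ * t * ε + δ ^ 2 * K with hβ
  have hβ0 : 0 ≤ β := by positivity
  set β' := β + L * κ * K * δ with hβ'
  have hβ'0 : 0 ≤ β' := by positivity
  -- final comparison
  have fin : ∀ (m : ℕ) (S D v : ℝ), m ≤ L → 0 ≤ D →
      v ≤ q * S ^ 2 + κ * D + β + κ * m * (D + K * δ) + m * β' →
      q ^ m * v ≤ q ^ (m + 1) * (S ^ 2 + κ * (m + 1 : ℕ) * D + (m + 1 : ℕ) * β') := by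
    intro m S D v hm hD hv
    rw [pow_succ, mul_assoc]
    refine mul_le_mul_of_nonneg_left (hv.trans ?_) (by positivity)
    have hmL : (m : ℝ) ≤ L := by exact_mod_cast hm
    have a1 : κ * m * (K * δ) ≤ L * κ * K * δ := by
      have : 0 ≤ κ * K * δ := by positivity
      nlinarith
    push_cast
    have a2 : 0 ≤ κ * (m + 1) * D + (m + 1) * β' := by positivity
    have a3 := mul_le_mul_of_nonneg_right hq1 a2
    linear_combination a3 + a1 + (by rw [hβ'] : β' = β + L * κ * K * δ)
  have := superm (Measure.pi fun _ : Fin (n + 1) => η) (stepT c) N L hL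
    (fun l θ => ENNReal.ofReal (q ^ (L - l) * ((∑ i, θ i ^ 2 - 1 - l * δ * f) ^ 2
      + κ * ((L - l : ℕ) : ℝ) * Dsq θ + ((L - l : ℕ) : ℝ) * β'))) (fun l hl θ => by
      obtain ⟨m, rfl⟩ : ∃ m, L = l + 1 + m := ⟨L - (l + 1), by omega⟩
      have em : l + 1 + m - l = m + 1 := by omega
      have em' : l + 1 + m - (l + 1) = m := by omega
      rw [em, em']
      set S := ∑ i, θ i ^ 2 - 1 - l * δ * f with hS
      have hD0 := Dsq_nonneg θ
      by_cases hD : Dsq θ ≤ 1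
      · obtain ⟨hdi, hdb, hri, hri2, hrb, hr2b⟩ := h1 θ hD
        simp only [stepT, if_pos hD, Dsq_step, Rsq_step]
        simp only [← hδ]
        have hrf : Integrable (fun x => (rho c θ x - f) ^ 2) (Measure.pi fun _ => η) := by
          have : (fun x => (rho c θ x - f) ^ 2)
              = fun x => rho c θ x ^ 2 + (-2 * f) * rho c θ x + f ^ 2 := by funext x; ring
          rw [this]
          exact (hri2.add (hri.const_mul _)).add (integrable_const _)
        have hrf1 : Integrable (fun x => rho c θ x - f) (Measure.pi fun _ => η) :=
          hri.sub (integrable_const _)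
        have e : ∀ x, q ^ m * ((∑ i, θ i ^ 2 + δ * rho c θ x - 1 - ((l + 1 : ℕ) : ℝ) * δ * f) ^ 2
            + κ * (m : ℝ) * (Dsq θ + δ * drr c θ x) + (m : ℝ) * β')
            = q ^ m * ((((S ^ 2 + κ * m * Dsq θ + m * β') + 2 * S * δ * (rho c θ x - f))
              + δ ^ 2 * (rho c θ x - f) ^ 2) + κ * m * δ * drr c θ x) := by
          intro x; rw [hS]; push_cast; ring
        have I1 := (integrable_const (S ^ 2 + κ * m * Dsq θ + m * β')
          (μ := Measure.pi fun _ : Fin (n + 1) => η))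
        have I2 := hrf1.const_mul (2 * S * δ)
        have I3 := hrf.const_mul (δ ^ 2)
        have I4 := hdi.const_mul (κ * m * δ)
        rw [← ofReal_integral_eq_lintegral_ofReal]
        · apply ENNReal.ofReal_le_ofReal
          simp only [e]
          rw [integral_const_mul]
          apply fin m S (Dsq θ) _ (by omega) hD0
          rw [integral_add (by exact (I1.add I2).add I3) I4, integral_add (by exact I1.add I2) I3,
            integral_add I1 I2, integral_const_mul, integral_const_mul, integral_const_mul,
            integral_sub hri (integrable_const _)]
          simp only [integral_const, probReal_univ, one_smul]
          have b1 := amgm (S := S) (r := ∫ x, rho c θ x ∂(Measure.pi fun _ => η) - f) hδ0 ht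
          have b2 := mul_le_mul_of_nonneg_left hrb (by positivity : 0 ≤ δ * t)
          have b3 := mul_le_mul_of_nonneg_left hr2b (by positivity : 0 ≤ δ ^ 2)
          have b4 := mul_le_mul_of_nonneg_left hdb (by positivity : 0 ≤ κ * m * δ)
          rw [hq, hβ]
          have b2' : δ * t * (K * Dsq θ + ε) = κ * Dsq θ + δ * t * ε := by rw [hκ]; ring
          rw [b2'] at b2
          linear_combination b1 + b2 + b3 + b4
        · simp only [e]
          exact (((I1.add I2).add I3).add I4).const_mul _
        · refine Eventually.of_forall fun x => ?_
          have e' := Dsq_nonneg (sgdPRStep (c / ((n : ℝ) + 1))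
            (fun _ => (Real.sqrt ((n : ℝ) + 1))⁻¹) θ x)
          rw [Dsq_step, ← hδ] at e'
          simp only [Pi.zero_apply]
          positivity
      · simp only [stepT, if_neg hD, lintegral_const, measure_univ, mul_one]
        apply ENNReal.ofReal_le_ofReal
        apply fin m S (Dsq θ) _ (by omega) hD0
        have b1 := amgm (S := S) (r := -f) hδ0 ht
        have b2 : δ * t * f ^ 2 ≤ κ * Dsq θ := by
          have hD' := not_le.mp hD
          have hfD : f ^ 2 ≤ K * Dsq θ := by nlinarith
          have := mul_le_mul_of_nonneg_left hfD (by positivity : 0 ≤ δ * t)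
          rw [hκ]
          linarith
        have b3 := mul_le_mul_of_nonneg_left hf (by positivity : 0 ≤ δ ^ 2)
        have b4 : 0 ≤ κ * m * (K * δ) := by positivity
        have b5 : 0 ≤ δ * t * ε := by positivity
        have e : ∑ i, θ i ^ 2 - 1 - ((l + 1 : ℕ) : ℝ) * δ * f = S - δ * f := by
          rw [hS]; push_cast; ring
        rw [e, hq, hβ]
        linear_combination b1 + b2 + b3 + b4 + b5) (e1v n)
  simpa [Dsq_e1v, Rsq_e1v] using this

end process
section final

lemma est {K t δ ε : ℝ} {L : ℕ} (hK : 0 ≤ K) (ht : 0 < t) (hδ : 0 < δ) (hε : 0 ≤ ε)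
    (hL : L * δ ≤ t) :
    (1 + δ / t) ^ L * (L * ((δ * t * ε + δ ^ 2 * K) + L * (δ * t * K) * K * δ))
      ≤ 3 * (t ^ 3 * K ^ 2 + t ^ 2 * ε + t * K * δ) := by
  have h1 : (1 + δ / t) ^ L ≤ 3 := by
    have a : 1 + δ / t ≤ Real.exp (δ / t) := by linarith [Real.add_one_le_exp (δ / t)]
    have b : (1 + δ / t) ^ L ≤ Real.exp (δ / t) ^ L := by gcongr
    rw [← Real.exp_nat_mul] at b
    have d : (L : ℝ) * (δ / t) ≤ 1 := by
      rw [← mul_div_assoc]; exact (div_le_one ht).mpr hL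
    have := Real.exp_le_exp.mpr d
    linarith [Real.exp_one_lt_d9]
  have h0 : 0 ≤ L * δ := by positivity
  have h2 : L * ((δ * t * ε + δ ^ 2 * K) + L * (δ * t * K) * K * δ)
      ≤ t ^ 3 * K ^ 2 + t ^ 2 * ε + t * K * δ := by
    have a1 := mul_le_mul_of_nonneg_right hL (by positivity : 0 ≤ t * ε)
    have a2 := mul_le_mul_of_nonneg_right hL (by positivity : 0 ≤ δ * K)
    have a3 := mul_le_mul_of_nonneg_right (pow_le_pow_left₀ h0 hL 2) (by positivity : 0 ≤ t * K ^ 2)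
    linear_combination a1 + a2 + a3
  exact mul_le_mul h1 h2 (by positivity) (by norm_num)

lemma interp_grid {E : Type*} [AddCommGroup E] [Module ℝ E] {δ : ℝ} (hδ : 0 < δ) (v : ℕ → E)
    (L : ℕ) : interp δ v (L * δ) = v L := by
  have h : max ((L : ℝ) * δ / δ) 0 = L := by
    rw [mul_div_assoc, div_self hδ.ne', mul_one]
    exact max_eq_left (Nat.cast_nonneg L)
  simp [interp, h]

lemma measurable_ext0 {d : ℕ} (N : ℕ) :
    Measurable (ext0 N : (Fin N → Fin d → ℝ) → ℕ → Fin d → ℝ) := by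
  refine measurable_pi_lambda _ fun l => ?_
  by_cases h : l < N
  · simp only [ext0, h, dif_pos]; fun_prop
  · simp only [ext0, h, dif_neg, not_false_eq_true]; exact measurable_const

lemma final {η : Measure ℝ} [IsProbabilityMeasure η]
    (hmom : ∀ n : ℕ, Integrable (fun x : ℝ => x ^ n) η)
    (hmean : ∫ x, x ∂η = 0) (hvar : ∫ x, x ^ 2 ∂η = 1) {c : ℝ} (hc : 0 < c)
    {u : ℝ → Fin 2 → Fin 2 → ℝ} (hu : prConv η c u) {g : ℝ} (hg : 0 < g) :
    ∃ t₀ : ℝ, 0 < t₀ ∧ ∀ t : ℝ, 0 < t → t ≤ t₀ → ∀ᶠ n : ℕ in atTop,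
      |u ((⌊t / (c / ((n : ℝ) + 1))⌋₊ : ℝ) * (c / ((n : ℝ) + 1))) 0 0 - 1
        - (⌊t / (c / ((n : ℝ) + 1))⌋₊ : ℝ) * (c / ((n : ℝ) + 1)) * fdrift η c| < 3 * g * t / 8 := by
  obtain ⟨K₀, hK₀, ε, hε, hε0, H₀⟩ := onestep hmom hmean hvar c
  set f := fdrift η c with hf
  obtain ⟨K, hK⟩ : ∃ K, K = K₀ + f ^ 2 := ⟨_, rfl⟩
  have hK0 : 0 ≤ K := by rw [hK]; positivity
  have hKK : K₀ ≤ K := by rw [hK]; linarith [sq_nonneg f]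
  have hfK : f ^ 2 ≤ K := by rw [hK]; linarith
  have H : ∀ (n : ℕ) (θ : Fin (n + 1) → ℝ), Dsq θ ≤ 1 →
        Integrable (drr c θ) (Measure.pi fun _ => η) ∧
        ∫ x, drr c θ x ∂(Measure.pi fun _ => η) ≤ K ∧
        Integrable (rho c θ) (Measure.pi fun _ => η) ∧
        Integrable (fun x => rho c θ x ^ 2) (Measure.pi fun _ => η) ∧
        (∫ x, rho c θ x ∂(Measure.pi fun _ => η) - f) ^ 2 ≤ K * Dsq θ + ε n ∧
        ∫ x, (rho c θ x - f) ^ 2 ∂(Measure.pi fun _ => η) ≤ K := by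
    intro n θ hD
    obtain ⟨a1, a2, a3, a4, a5, a6⟩ := H₀ n θ hD
    refine ⟨a1, a2.trans hKK, a3, a4, a5.trans ?_, a6.trans hKK⟩
    have := mul_le_mul_of_nonneg_right hKK (Dsq_nonneg θ)
    linarith
  refine ⟨min 1 (min (1 / (8 * (K + 1))) (g ^ 2 / (384 * (K ^ 2 + 1)))), by positivity, ?_⟩
  intro t ht htt
  have t1 : t ≤ 1 := htt.trans (min_le_left _ _)
  have t2 : K * t ≤ 1 / 4 := by
    have := htt.trans ((min_le_right _ _).trans (min_le_left _ _))
    rw [le_div_iff₀ (by positivity)] at this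
    nlinarith
  have t3 : t * K ^ 2 ≤ g ^ 2 / 384 := by
    have := htt.trans ((min_le_right _ _).trans (min_le_right _ _))
    rw [le_div_iff₀ (by positivity)] at this
    nlinarith
  have hδlim : Tendsto (fun n : ℕ => c / ((n : ℝ) + 1)) atTop (nhds 0) :=
    tendsto_const_div_atTop_nhds_zero_nat c |>.comp (tendsto_add_atTop_nat 1) |>.congr
      (fun n => by simp)
  have hsmall : ∀ᶠ n : ℕ in atTop,
      3 * (t ^ 2 * ε n + t * K * (c / ((n : ℝ) + 1))) < g ^ 2 * t ^ 2 / 128 := by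
    have : Tendsto (fun n : ℕ => 3 * (t ^ 2 * ε n + t * K * (c / ((n : ℝ) + 1)))) atTop
        (nhds (3 * (t ^ 2 * 0 + t * K * 0))) :=
      ((hε.const_mul _).add (hδlim.const_mul _)).const_mul _
    exact this.eventually_lt_const (by simp only [mul_zero, add_zero]; positivity)
  have hconv := (hu 1 one_pos (g * t / 8) (by positivity)).comp (tendsto_add_atTop_nat 1)
  have hconv' := hconv.eventually_lt_const (show (0 : ENNReal) < ENNReal.ofReal (1 / 4) by
    rw [ENNReal.ofReal_pos]; norm_num)
  filter_upwards [hsmall, hconv'] with n hn1 hn2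
  simp only [Function.comp_apply, Nat.cast_add, Nat.cast_one] at hn2
  obtain ⟨δ, hδ⟩ : ∃ δ, δ = c / ((n : ℝ) + 1) := ⟨_, rfl⟩
  have hδ0 : 0 < δ := by rw [hδ]; positivity
  obtain ⟨L, hL⟩ : ∃ L, L = ⌊t / (c / ((n : ℝ) + 1))⌋₊ := ⟨_, rfl⟩
  obtain ⟨N, hN⟩ : ∃ N, N = ⌈((1 : ℝ) + 1) * (c / ((n : ℝ) + 1))⁻¹⌉₊ + 2 := ⟨_, rfl⟩
  rw [← hN] at hn2
  rw [← hL, ← hδ]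
  have hLt : L * δ ≤ t := by
    have := Nat.floor_le (show 0 ≤ t / (c / ((n : ℝ) + 1)) by positivity)
    rw [← hL, ← hδ] at this
    exact (le_div_iff₀ hδ0).mp this
  have hLN : L ≤ N := by
    have : ⌊t / (c / ((n : ℝ) + 1))⌋₊ ≤ ⌈((1 : ℝ) + 1) * (c / ((n : ℝ) + 1))⁻¹⌉₊ := by
      refine (Nat.floor_mono ?_).trans (Nat.floor_le_ceil _)
      rw [div_eq_mul_inv, ← hδ]
      have : 0 < δ⁻¹ := by positivity
      nlinarith
    omega
  set P := Measure.pi fun _ : Fin N => Measure.pi fun _ : Fin (n + 1) => η with hP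
  -- bad events
  have A1 : P {ω | 1 ≤ ENNReal.ofReal (Dsq (chainF (stepT c) (e1v n) (ext0 N ω) L))}
      ≤ ENNReal.ofReal (1 / 4) := by
    have h := lyapD (η := η) (n := n) hc hK0 (fun θ h => ⟨(H n θ h).1, (H n θ h).2.1⟩) N L hLN
    have m := mul_meas_ge_le_lintegral (μ := P)
      ((measurable_Dsq.comp (measurable_chain (n := n) c N L)).ennreal_ofReal) 1
    rw [one_mul] at m
    refine m.trans (h.trans (ENNReal.ofReal_le_ofReal ?_))
    rw [← hδ]
    have := mul_le_mul_of_nonneg_left hLt hK0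
    linarith
  have A2 : P {ω | ENNReal.ofReal ((g * t / 4) ^ 2) ≤ ENNReal.ofReal
      ((∑ i, chainF (stepT c) (e1v n) (ext0 N ω) L i ^ 2 - 1 - L * δ * f) ^ 2)}
      ≤ ENNReal.ofReal (1 / 4) := by
    have h := lyapS (η := η) (n := n) hc hK0 (hε0 n) ht hfK (H n) N L hLN δ hδ
    have hm : Measurable (fun ω : Fin N → Fin (n + 1) → ℝ => ENNReal.ofReal
      ((∑ i, chainF (stepT c) (e1v n) (ext0 N ω) L i ^ 2 - 1 - L * δ * f) ^ 2)) := by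
      have := measurable_chain (n := n) c N L
      refine Measurable.ennreal_ofReal (Measurable.pow_const (Measurable.sub_const
        (Measurable.sub_const (Finset.measurable_sum _ fun i _ => ?_) _) _) 2)
      exact ((measurable_pi_apply i).comp this).pow_const 2
    have m := mul_meas_ge_le_lintegral (μ := P) hm (ENNReal.ofReal ((g * t / 4) ^ 2))
    have hpos : 0 < (g * t / 4) ^ 2 := by positivity
    have e := est (L := L) hK0 ht hδ0 (hε0 n) hLt
    have b : (1 + δ / t) ^ L * (L * ((δ * t * ε n + δ ^ 2 * K) + L * (δ * t * K) * K * δ))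
        ≤ (g * t / 4) ^ 2 * (1 / 4) := by
      rw [← hδ] at hn1
      have := mul_le_mul_of_nonneg_right t3 (sq_nonneg t)
      nlinarith
    have m' := m.trans (h.trans (ENNReal.ofReal_le_ofReal b))
    rw [ENNReal.ofReal_mul hpos.le] at m'
    exact (ENNReal.mul_le_mul_iff_right (by rw [ne_eq, ENNReal.ofReal_eq_zero]; linarith)
      ENNReal.ofReal_ne_top).mp m'
  rw [← hδ] at hn2
  set B := {ω : ℕ → Fin (n + 1) → ℝ | ∃ s ∈ Set.Icc (0 : ℝ) 1,
            g * t / 8 ≤ ‖interp δ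
                  (fun ℓ => gram2
                    (sgdPR δ (fun _ => (Real.sqrt ((n : ℝ) + 1))⁻¹)
                      (fun i => if (i : ℕ) = 0 then 1 else 0) ω ℓ)
                    (fun _ => (Real.sqrt ((n : ℝ) + 1))⁻¹)) s
                - u s‖} with hB
  have A3 : P (ext0 N ⁻¹' B) < ENNReal.ofReal (1 / 4) :=
    lt_of_le_of_lt (Measure.le_map_apply (measurable_ext0 N).aemeasurable B) hn2
  -- a good sample exists
  obtain ⟨ω, w1, w2, w3⟩ : ∃ ω : Fin N → Fin (n + 1) → ℝ,
      ¬ (1 ≤ ENNReal.ofReal (Dsq (chainF (stepT c) (e1v n) (ext0 N ω) L))) ∧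
      ¬ (ENNReal.ofReal ((g * t / 4) ^ 2) ≤ ENNReal.ofReal
      ((∑ i, chainF (stepT c) (e1v n) (ext0 N ω) L i ^ 2 - 1 - L * δ * f) ^ 2)) ∧
      ext0 N ω ∉ B := by
    by_contra hcon
    push Not at hcon
    have hcov : (Set.univ : Set (Fin N → Fin (n + 1) → ℝ)) ⊆
        ({ω | 1 ≤ ENNReal.ofReal (Dsq (chainF (stepT c) (e1v n) (ext0 N ω) L))} ∪
        {ω | ENNReal.ofReal ((g * t / 4) ^ 2) ≤ ENNReal.ofReal
      ((∑ i, chainF (stepT c) (e1v n) (ext0 N ω) L i ^ 2 - 1 - L * δ * f) ^ 2)}) ∪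
        (ext0 N ⁻¹' B) := by
      intro ω _
      by_cases h1 : 1 ≤ ENNReal.ofReal (Dsq (chainF (stepT c) (e1v n) (ext0 N ω) L))
      · exact Or.inl (Or.inl h1)
      · by_cases h2 : ENNReal.ofReal ((g * t / 4) ^ 2) ≤ ENNReal.ofReal
          ((∑ i, chainF (stepT c) (e1v n) (ext0 N ω) L i ^ 2 - 1 - L * δ * f) ^ 2)
        · exact Or.inl (Or.inr h2)
        · exact Or.inr (hcon ω (not_le.mp h1) (not_le.mp h2))
    have h1 : (1 : ENNReal) ≤ ENNReal.ofReal (1 / 4) + ENNReal.ofReal (1 / 4)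
        + ENNReal.ofReal (1 / 4) := by
      calc (1 : ENNReal) = P Set.univ := measure_univ.symm
        _ ≤ _ := measure_mono hcov
        _ ≤ _ := measure_union_le _ _
        _ ≤ _ := add_le_add ((measure_union_le _ _).trans (add_le_add A1 A2)) A3.le
    rw [← ENNReal.ofReal_add (by norm_num) (by norm_num),
      ← ENNReal.ofReal_add (by norm_num) (by norm_num), ← ENNReal.ofReal_one,
      ENNReal.ofReal_le_ofReal_iff (by norm_num)] at h1
    norm_num at h1
  have hD : Dsq (chainF (stepT c) (e1v n) (ext0 N ω) L) ≤ 1 := by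
    by_contra hcon
    exact w1 (ENNReal.one_le_ofReal.mpr (not_le.mp hcon).le)
  have hS : |∑ i, chainF (stepT c) (e1v n) (ext0 N ω) L i ^ 2 - 1 - L * δ * f| < g * t / 4 := by
    by_contra hcon
    refine w2 (ENNReal.ofReal_le_ofReal ?_)
    rw [← sq_abs (_ - _ - _)]
    exact pow_le_pow_left₀ (by positivity) (not_lt.mp hcon) 2
  have hch := chain_eq_sgd c (ext0 N ω) L hD
  rw [← hδ] at hch
  have hU : ‖gram2 (chainF (stepT c) (e1v n) (ext0 N ω) L)
      (fun _ => (Real.sqrt ((n : ℝ) + 1))⁻¹) - u (L * δ)‖ < g * t / 8 := by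
    by_contra hcon
    refine w3 ⟨L * δ, ⟨by positivity, hLt.trans t1⟩, ?_⟩
    rw [interp_grid hδ0, show (fun i : Fin (n + 1) => if (i : ℕ) = 0 then (1 : ℝ) else 0) = e1v n
      from rfl, ← hch]
    exact not_lt.mp hcon
  have hpi : ∀ M : Fin 2 → Fin 2 → ℝ, ‖M 0 0‖ ≤ ‖M‖ := fun M =>
    (norm_le_pi_norm (M 0) 0).trans (norm_le_pi_norm M 0)
  have hU2 := (hpi _).trans_lt hU
  have hgr : gram2 (chainF (stepT c) (e1v n) (ext0 N ω) L)
      (fun _ => (Real.sqrt ((n : ℝ) + 1))⁻¹) 0 0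
      = ∑ i, chainF (stepT c) (e1v n) (ext0 N ω) L i ^ 2 := by
    simp [gram2, sq]
  simp only [Pi.sub_apply, Real.norm_eq_abs, hgr] at hU2
  rw [abs_lt] at hU2 hS ⊢
  constructor <;> linarith [hU2.1, hU2.2, hS.1, hS.2]

end final
/-- non-universality with coordinate-aligned initialization. For the
smooth phase retrieval loss with `θ* = d^{-1/2}𝟙` and i.i.d. features `Xᵢ ~ ν` (centered,
unit variance, all moments finite, `E[X₁⁴] ≠ 3`), for all except at most one value of
`c_LR > 0`, if SGD at rate `δ = c_LR/d` is initialized at `θ₀ = e₁`, then the summary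
statistic trajectories do not converge to the deterministic ODE limit that they follow
under i.i.d. standard Gaussian features. -/
theorem no_ballistic_universality_coordinate_aligned
    (ν : Measure ℝ) [IsProbabilityMeasure ν]
    (hmom : ∀ n : ℕ, Integrable (fun x : ℝ => |x| ^ n) ν)
    (hmean : ∫ x, x ∂ν = 0) (hvar : ∫ x, x ^ 2 ∂ν = 1)
    (hm₄ : ∫ x, x ^ 4 ∂ν ≠ 3) :
    ∃ c₀ : ℝ, ∀ cLR : ℝ, 0 < cLR → cLR ≠ c₀ →
      ∀ u : ℝ → Fin 2 → Fin 2 → ℝ,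
        prConv (gaussianReal 0 1) cLR u → ¬ prConv ν cLR u := by
  have conv : ∀ (η : Measure ℝ), (∀ n : ℕ, Integrable (fun x : ℝ => |x| ^ n) η) →
      ∀ n : ℕ, Integrable (fun x : ℝ => x ^ n) η := by
    intro η h n
    refine (h n).mono (by fun_prop) (Eventually.of_forall fun x => ?_)
    simp
  obtain ⟨G4, G6, G2⟩ := gauss46
  set m4 := ∫ x, x ^ 4 ∂ν with hm4
  set m6 := ∫ x, x ^ 6 ∂ν with hm6
  refine ⟨(m4 - 3) / (2 * (m6 - 15 - 2 * (m4 - 3))), fun c hc hne u huG huν => ?_⟩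
  have hdiff : fdrift ν c - fdrift (gaussianReal 0 1) c ≠ 0 := by
    have e : fdrift ν c - fdrift (gaussianReal 0 1) c
        = -8 * (m4 - 3) + 16 * c * (m6 - 15 - 2 * (m4 - 3)) := by
      rw [fdrift, fdrift, G4, G6]; ring
    rw [e]
    intro h0
    by_cases hz : m6 - 15 - 2 * (m4 - 3) = 0
    · rw [hz] at h0
      exact hm₄ (by linarith)
    · apply hne
      rw [eq_div_iff (by simpa using hz)]
      linarith
  have hg : 0 < |fdrift ν c - fdrift (gaussianReal 0 1) c| := abs_pos.mpr hdiff
  obtain ⟨t1, ht1, h1⟩ := final (conv ν hmom) hmean hvar hc huν hg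
  obtain ⟨t2, ht2, h2⟩ := final (conv _ gauss_int) integral_id_gaussianReal G2 hc huG hg
  obtain ⟨t, ht⟩ : ∃ t, t = min t1 t2 := ⟨_, rfl⟩
  have ht0 : 0 < t := by rw [ht]; positivity
  have a1 := h1 t ht0 (by rw [ht]; exact min_le_left _ _)
  have a2 := h2 t ht0 (by rw [ht]; exact min_le_right _ _)
  have hδlim : Tendsto (fun n : ℕ => c / ((n : ℝ) + 1)) atTop (nhds 0) :=
    tendsto_const_div_atTop_nhds_zero_nat c |>.comp (tendsto_add_atTop_nat 1) |>.congr
      (fun n => by simp)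
  have a3 := hδlim.eventually_lt_const (show 0 < t / 4 by positivity)
  obtain ⟨n, b1, b2, b3⟩ := (a1.and (a2.and a3)).exists
  have hδ0 : 0 < c / ((n : ℝ) + 1) := by positivity
  have hfl := Nat.lt_floor_add_one (t / (c / ((n : ℝ) + 1)))
  rw [div_lt_iff₀ hδ0] at hfl
  generalize hs : (⌊t / (c / ((n : ℝ) + 1))⌋₊ : ℝ) * (c / ((n : ℝ) + 1)) = s at b1 b2
  have hs1 : 3 * t / 4 < s := by rw [← hs]; linarith
  generalize fdrift ν c = f1 at *
  generalize fdrift (gaussianReal 0 1) c = f2 at *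
  have key : |s * (f1 - f2)| < 3 * |f1 - f2| * t / 4 := by
    rw [abs_lt] at b1 b2 ⊢
    constructor <;> linarith [b1.1, b1.2, b2.1, b2.2]
  rw [abs_mul, abs_of_pos (by linarith : 0 < s)] at key
  nlinarith
end
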